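/- arXiv:2502.02186 — 2 statements merged into one kernel-verified Lean document; each statement's English description precedes it below -/
import Mathlib

section
/- There is a universal constant C > 0 such that for every γ ≥ 1, all p, q with p* ≥ 2 and q ≥ 2, all positive integers m, n, and every real m×n matrix A = (a_{ij}): E sup_{s ∈ B_{q*}^m} sup_{t ∈ B_p^n} Σ_{i≤m, j≤n} a_{ij} g_{ij} s_i t_j · 1_{{|s_i| ≥ γ^{-1}}} ≤ C·( √(p*)·D1 + √(γ^{q*}·Log m)·max_{i,j} |a_{ij}| ). -/
open MeasureTheory ProbabilityTheory
open scoped ENNReal NNReal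

noncomputable section

/-- The `ℓ_r` norm of a finite real vector, `r ∈ [1,∞]`. -/
def lpNorm (r : ℝ≥0∞) {ι : Type*} [Fintype ι] (x : ι → ℝ) : ℝ :=
  if r = ⊤ then ⨆ i, |x i| else (∑ i, |x i| ^ r.toReal) ^ (1 / r.toReal)

/-- The operator norm `‖M‖_{p→q}` expressed via the conjugate exponent `q*`:
the supremum of the bilinear form over `s` in the unit ball of `ℓ_{q*}` and
`t` in the unit ball of `ℓ_p`. -/
def opNorm (p qstar : ℝ≥0∞) {ι κ : Type*} [Fintype ι] [Fintype κ]
    (M : ι → κ → ℝ) : ℝ :=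
  sSup { x : ℝ | ∃ s : ι → ℝ, ∃ t : κ → ℝ,
    lpNorm qstar s ≤ 1 ∧ lpNorm p t ≤ 1 ∧ x = ∑ i, ∑ j, M i j * s i * t j }

/-- The standard Gaussian product measure on `ι → ℝ` (iid `N(0,1)` coordinates). -/
def stdGaussian (ι : Type*) [Fintype ι] : Measure (ι → ℝ) :=
  Measure.pi fun _ => gaussianReal 0 1

/-- `Log x = max 1 (ln x)`; in particular `Log 0 = 1`. -/
def Log (x : ℝ) : ℝ := max 1 (Real.log x)

/-- `E‖G_A‖_{p→q}` for the Gaussian matrix `G_A = (a_{ij} g_{ij})`. -/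
def EopNorm (p qstar : ℝ≥0∞) {m n : ℕ} (A : Fin m → Fin n → ℝ) : ℝ :=
  ∫ g : Fin m × Fin n → ℝ,
    opNorm p qstar (fun i j => A i j * g (i, j)) ∂ stdGaussian (Fin m × Fin n)

/-- `D1 = max_i ‖(a_{ij})_j‖_{p*}`. -/
def D1 (pstar : ℝ≥0∞) {m n : ℕ} (A : Fin m → Fin n → ℝ) : ℝ :=
  ⨆ i, lpNorm pstar (fun j => A i j)

/-- `D2 = max_j ‖(a_{ij})_i‖_q`. -/
def D2 (q : ℝ≥0∞) {m n : ℕ} (A : Fin m → Fin n → ℝ) : ℝ :=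
  ⨆ j, lpNorm q (fun i => A i j)

/-- `max_{i,j} |a_{ij}|`. -/
def maxEntry {m n : ℕ} (A : Fin m → Fin n → ℝ) : ℝ :=
  ⨆ ij : Fin m × Fin n, |A ij.1 ij.2|

/-- `max_{k ≥ 0} inf_{I ⊂ [m]×[n], |I| = k} √(Log k) · max_{(i,j) ∉ I} |a_{ij}|`
(for `k > mn` the term vanishes, so `k` ranges over `0,…,mn`). -/
def Dinf {m n : ℕ} (A : Fin m → Fin n → ℝ) : ℝ :=
  ⨆ k : Fin (m * n + 1),
    ⨅ I : { I : Finset (Fin m × Fin n) // I.card = k.1 },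
      Real.sqrt (Log (k.1 : ℝ)) *
        ⨆ ij : { ij : Fin m × Fin n // ij ∉ I.1 }, |A ij.1.1 ij.1.2|

/-- `E max_{i,j} |a_{ij} g_{ij}|`. -/
def EmaxGauss {m n : ℕ} (A : Fin m → Fin n → ℝ) : ℝ :=
  ∫ g : Fin m × Fin n → ℝ,
    (⨆ ij : Fin m × Fin n, |A ij.1 ij.2 * g ij|) ∂ stdGaussian (Fin m × Fin n)

/-- The truncated exponential series `∑_{i ≤ k} z ^ i / i!`. -/
def truncExp (k : ℕ) (z : ℝ) : ℝ := ∑ i ∈ Finset.range (k + 1), z ^ i / (i.factorial : ℝ)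

theorem one_le_truncExp (k : ℕ) {z : ℝ} (hz : 0 ≤ z) : 1 ≤ truncExp k z := by
  unfold truncExp
  rw [Finset.sum_range_succ']
  simp only [pow_zero, Nat.factorial_zero, Nat.cast_one, div_one]
  have : 0 ≤ ∑ i ∈ Finset.range k, z ^ (i + 1) / ((i + 1).factorial : ℝ) :=
    Finset.sum_nonneg fun i _ => by positivity
  linarith

theorem truncExp_add_le (k : ℕ) {a b : ℝ} (ha : 0 ≤ a) (hb : 0 ≤ b) :
    truncExp k (a + b) ≤ truncExp k a * truncExp k b := by
  unfold truncExp
  have h1 : ∀ i ∈ Finset.range (k + 1), (a + b) ^ i / (i.factorial : ℝ) =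
      ∑ l ∈ Finset.range (i + 1),
        a ^ l / (l.factorial : ℝ) * (b ^ (i - l) / ((i - l).factorial : ℝ)) := by
    intro i _
    rw [add_pow, Finset.sum_div]
    refine Finset.sum_congr rfl fun l hl => ?_
    rw [Nat.cast_choose ℝ (Nat.lt_succ_iff.mp (Finset.mem_range.mp hl))]
    have := Nat.factorial_ne_zero i
    field_simp
  rw [Finset.sum_congr rfl h1, Finset.sum_range_diag_flip (k + 1)
    (fun l j => a ^ l / (l.factorial : ℝ) * (b ^ j / (j.factorial : ℝ))), Finset.sum_mul_sum]
  refine Finset.sum_le_sum fun l _ => ?_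
  refine Finset.sum_le_sum_of_subset_of_nonneg ?_ fun j _ _ => by positivity
  exact Finset.range_subset_range.mpr (Nat.sub_le _ _)

theorem truncExp_sum_le (k : ℕ) {ι : Type*} (s : Finset ι) {z : ι → ℝ} (hz : ∀ i, 0 ≤ z i) :
    truncExp k (∑ i ∈ s, z i) ≤ ∏ i ∈ s, truncExp k (z i) := by
  classical
  induction s using Finset.induction_on with
  | empty => simp [truncExp, Finset.sum_range_succ']
  | insert i s hi ih =>
    rw [Finset.sum_insert hi, Finset.prod_insert hi]
    refine (truncExp_add_le k (hz i) (Finset.sum_nonneg fun j _ => hz j)).trans ?_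
    exact mul_le_mul_of_nonneg_left ih (zero_le_one.trans (one_le_truncExp k (hz i)))

theorem pow_le_prod_truncExp (k : ℕ) {ι : Type*} (s : Finset ι) {z : ι → ℝ}
    (hz : ∀ i, 0 ≤ z i) :
    (∑ i ∈ s, z i) ^ k ≤ (k.factorial : ℝ) * ∏ i ∈ s, truncExp k (z i) := by
  have h0 : 0 ≤ ∑ i ∈ s, z i := Finset.sum_nonneg fun j _ => hz j
  have h1 : (∑ i ∈ s, z i) ^ k / (k.factorial : ℝ) ≤ truncExp k (∑ i ∈ s, z i) :=
    Finset.single_le_sum (f := fun i => (∑ j ∈ s, z j) ^ i / (i.factorial : ℝ))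
      (fun i _ => by positivity) (Finset.self_mem_range_succ k)
  have h2 := h1.trans (truncExp_sum_le k s hz)
  rw [div_le_iff₀ (by positivity)] at h2
  linarith

instance (ι : Type*) [Fintype ι] : IsProbabilityMeasure (stdGaussian ι) := by
  unfold _root_.stdGaussian
  infer_instance

theorem map_uncurry_stdGaussian (ι κ : Type*) [Fintype ι] [Fintype κ] :
    (Measure.pi fun _ : κ => stdGaussian ι).map (fun y (ij : ι × κ) => y ij.2 ij.1) =
      stdGaussian (ι × κ) := by
  unfold _root_.stdGaussian
  refine (Measure.pi_eq fun s hs => ?_).symm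
  rw [Measure.map_apply (by fun_prop) (MeasurableSet.univ_pi hs)]
  have : (fun (y : κ → ι → ℝ) (ij : ι × κ) => y ij.2 ij.1) ⁻¹' (Set.univ.pi s) =
      Set.univ.pi fun j => Set.univ.pi fun i => s (i, j) := by
    ext y
    simp only [Set.mem_preimage, Set.mem_pi, Set.mem_univ, true_imp_iff, Prod.forall]
    exact forall_comm
  rw [this, Measure.pi_pi]
  simp_rw [Measure.pi_pi]
  rw [← Finset.univ_product_univ, Finset.prod_product_right]

theorem hasSubgaussianMGF_linear {ι : Type*} [Fintype ι] (w : ι → ℝ) :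
    HasSubgaussianMGF (fun x : ι → ℝ => ∑ i, w i * x i) (∑ i, (w i ^ 2).toNNReal)
      (stdGaussian ι) := by
  unfold _root_.stdGaussian
  have hind : iIndepFun (fun i (x : ι → ℝ) => w i * x i)
      (Measure.pi fun _ : ι => gaussianReal 0 1) :=
    iIndepFun_pi (X := fun i (x : ℝ) => w i * x) fun i => by fun_prop
  refine HasSubgaussianMGF.sum_of_iIndepFun hind fun i _ => ?_
  have hmap : (Measure.pi fun _ : ι => gaussianReal 0 1).map (fun x => x i) = gaussianReal 0 1 :=
    (measurePreserving_eval (fun _ : ι => gaussianReal 0 1) i).map_eq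
  have h1 : HasSubgaussianMGF (fun x : ι → ℝ => x i) 1
      (Measure.pi fun _ : ι => gaussianReal 0 1) := by
    refine ⟨fun t => ?_, fun t => ?_⟩
    · have := integrable_exp_mul_gaussianReal (μ := 0) (v := 1) t
      rw [← hmap] at this
      exact this.comp_measurable (by fun_prop)
    · rw [mgf_gaussianReal hmap]
      simp
  have h2 := h1.const_mul (w i)
  convert! h2 using 1
  refine NNReal.eq ?_
  rw [Real.coe_toNNReal _ (sq_nonneg _)]
  exact (mul_one (w i ^ 2)).symm

theorem abs_rpow_le_exp {u l x : ℝ} (hu : 0 < u) (hl : 0 < l) :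
    |x| ^ u ≤ (u / (Real.exp 1 * l)) ^ u * (Real.exp (l * x) + Real.exp (-l * x)) := by
  have h1 : |x| ≤ u / (Real.exp 1 * l) * Real.exp (l * |x| / u) := by
    have := Real.add_one_le_exp (l * |x| / u - 1)
    rw [sub_add_cancel, Real.exp_sub, le_div_iff₀ (Real.exp_pos 1)] at this
    rw [div_mul_eq_mul_div, le_div_iff₀ (by positivity)]
    have h2 := mul_le_mul_of_nonneg_left this hu.le
    calc |x| * (Real.exp 1 * l) = u * (l * |x| / u * Real.exp 1) := by field_simp
      _ ≤ _ := h2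
  have h3 : Real.exp (l * |x|) ≤ Real.exp (l * x) + Real.exp (-l * x) := by
    rcases abs_cases x with h | h
    · rw [h.1]; linarith [Real.exp_pos (-l * x)]
    · rw [h.1, mul_neg, neg_mul]; linarith [Real.exp_pos (l * x)]
  calc |x| ^ u ≤ (u / (Real.exp 1 * l) * Real.exp (l * |x| / u)) ^ u := by gcongr
    _ = (u / (Real.exp 1 * l)) ^ u * Real.exp (l * |x|) := by
      rw [Real.mul_rpow (by positivity) (by positivity), ← Real.exp_mul]
      congr 2
      field_simp
    _ ≤ _ := by gcongr

theorem integrable_abs_rpow_of_subgaussian {Ω : Type*} {mΩ : MeasurableSpace Ω} {μ : Measure Ω}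
    {X : Ω → ℝ} {c : ℝ≥0} (h : HasSubgaussianMGF X c μ) {u : ℝ} (hu : 0 < u) :
    Integrable (fun ω => |X ω| ^ u) μ := by
  refine Integrable.mono' (((h.integrable_exp_mul 1).add (h.integrable_exp_mul (-1))).const_mul
    ((u / (Real.exp 1 * 1)) ^ u)) ?_ (ae_of_all _ fun ω => ?_)
  · exact (h.aemeasurable.abs.pow_const u).aestronglyMeasurable
  · rw [Real.norm_of_nonneg (by positivity)]
    exact abs_rpow_le_exp hu one_pos

theorem integral_abs_rpow_le_of_subgaussian {Ω : Type*} {mΩ : MeasurableSpace Ω} {μ : Measure Ω}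
    [IsProbabilityMeasure μ]
    {X : Ω → ℝ} {c : ℝ≥0} (h : HasSubgaussianMGF X c μ) {u : ℝ} (hu : 0 < u) :
    ∫ ω, |X ω| ^ u ∂μ ≤ 2 * (Real.sqrt u * Real.sqrt c) ^ u := by
  rcases eq_or_ne c 0 with rfl | hc
  · have h0 : (fun ω => |X ω| ^ u) =ᵐ[μ] fun _ => 0 := by
      filter_upwards [h.ae_eq_zero_of_hasSubgaussianMGF_zero] with ω hω
      simp [hω, hu.ne']
    rw [integral_congr_ae h0]
    simp [hu.ne']
  have hc' : 0 < (c : ℝ) := by exact_mod_cast pos_iff_ne_zero.mpr hc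
  set l : ℝ := Real.sqrt u / Real.sqrt c with hl
  have hsc : 0 < Real.sqrt c := Real.sqrt_pos.mpr hc'
  have hsu : 0 < Real.sqrt u := Real.sqrt_pos.mpr hu
  have hl0 : 0 < l := by positivity
  have hlc : (c : ℝ) * l ^ 2 = u := by
    rw [hl, div_pow, Real.sq_sqrt hc'.le, Real.sq_sqrt hu.le]
    field_simp
  have e1 := h.mgf_le l
  have e2 := h.mgf_le (-l)
  rw [neg_sq] at e2
  rw [hlc] at e1 e2
  have hul : u / (Real.exp 1 * l) = Real.sqrt u * Real.sqrt c / Real.exp 1 := by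
    rw [hl]
    field_simp
    rw [Real.sq_sqrt hu.le]
  calc ∫ ω, |X ω| ^ u ∂μ
      ≤ ∫ ω, (u / (Real.exp 1 * l)) ^ u * (Real.exp (l * X ω) + Real.exp (-l * X ω)) ∂μ :=
        integral_mono (integrable_abs_rpow_of_subgaussian h hu)
          (((h.integrable_exp_mul l).add (h.integrable_exp_mul (-l))).const_mul _)
          fun ω => abs_rpow_le_exp hu hl0
    _ = (u / (Real.exp 1 * l)) ^ u * (mgf X μ l + mgf X μ (-l)) := by
        rw [integral_const_mul, integral_add (h.integrable_exp_mul l) (h.integrable_exp_mul (-l))]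
        rfl
    _ ≤ (u / (Real.exp 1 * l)) ^ u * (Real.exp (u / 2) + Real.exp (u / 2)) := by gcongr
    _ = 2 * (Real.sqrt u * Real.sqrt c) ^ u * (Real.exp (u / 2) / Real.exp u) := by
        rw [hul, Real.div_rpow (by positivity) (by positivity), ← Real.exp_mul, one_mul]
        ring
    _ ≤ 2 * (Real.sqrt u * Real.sqrt c) ^ u * 1 := by
        gcongr
        rw [div_le_one (Real.exp_pos _)]
        exact Real.exp_le_exp.mpr (by linarith)
    _ = _ := mul_one _

theorem sqrt_rpow_eq {x : ℝ} (hx : 0 ≤ x) (r : ℝ) : Real.sqrt x ^ r = x ^ (r / 2) := by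
  rw [Real.sqrt_eq_rpow, ← Real.rpow_mul hx]
  congr 1
  ring

theorem pow_mul_rpow_pow_div_factorial_le {k i : ℕ} (hi : 1 ≤ i) (hik : i ≤ k) {ρ : ℝ}
    (hρ : 1 ≤ ρ) :
    (k : ℝ) ^ i * ((i : ℝ) ^ ρ) ^ i / (i.factorial : ℝ) ≤
      k * Real.exp ρ ^ i * ((k : ℝ) ^ ρ) ^ (i - 1) := by
  obtain ⟨l, rfl⟩ : ∃ l, i = l + 1 := ⟨i - 1, by omega⟩
  simp only [Nat.add_sub_cancel]
  set x : ℝ := ((l + 1 : ℕ) : ℝ) with hx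
  have hx0 : 0 < x := by rw [hx]; positivity
  have hxk : x ≤ k := by rw [hx]; exact_mod_cast hik
  have hk0 : (0 : ℝ) < k := hx0.trans_le hxk
  have e1 : ∀ y : ℝ, 0 < y → y ^ ρ = y * y ^ (ρ - 1) := fun y hy => by
    rw [Real.rpow_sub_one hy.ne', mul_div_cancel₀ _ hy.ne']
  have e2 : x ^ (l + 1) / ((l + 1).factorial : ℝ) ≤ Real.exp 1 ^ (l + 1) := by
    refine (Real.pow_div_factorial_le_exp x hx0.le (l + 1)).trans_eq ?_
    rw [← Real.exp_nat_mul, mul_one]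
  have e3 : x ^ (ρ - 1) ≤ Real.exp (ρ - 1) ^ (l + 1) := by
    rw [← Real.exp_nat_mul, ← hx, Real.exp_mul]
    exact Real.rpow_le_rpow hx0.le (by linarith [Real.add_one_le_exp x]) (by linarith)
  have e4 : x ^ (ρ - 1) ≤ (k : ℝ) ^ (ρ - 1) := Real.rpow_le_rpow hx0.le hxk (by linarith)
  calc (k : ℝ) ^ (l + 1) * (x ^ ρ) ^ (l + 1) / ((l + 1).factorial : ℝ)
      = (k : ℝ) ^ (l + 1) * (x ^ (l + 1) / ((l + 1).factorial : ℝ)) *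
          ((x ^ (ρ - 1)) ^ l * x ^ (ρ - 1)) := by rw [e1 x hx0]; ring
    _ ≤ (k : ℝ) ^ (l + 1) * Real.exp 1 ^ (l + 1) *
          (((k : ℝ) ^ (ρ - 1)) ^ l * Real.exp (ρ - 1) ^ (l + 1)) := by gcongr
    _ = k * (Real.exp 1 * Real.exp (ρ - 1)) ^ (l + 1) * (k * (k : ℝ) ^ (ρ - 1)) ^ l := by ring
    _ = _ := by rw [← Real.exp_add, add_sub_cancel, e1 k hk0]

/-- The scale of the `ℓ_r` norm of a centred Gaussian vector at moments of order `r * k`. -/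
def momentScale (r D a : ℝ) (k : ℕ) : ℝ :=
  2 * Real.exp 1 * Real.sqrt r * (D + Real.sqrt k * a)

theorem momentScale_pos {r D a : ℝ} (hr : 2 ≤ r) (hD : 0 < D) (ha : 0 ≤ a) (k : ℕ) :
    0 < momentScale r D a k := by
  have : 0 < Real.sqrt r := Real.sqrt_pos.mpr (by linarith)
  unfold momentScale
  positivity

theorem moment_term_le {k i : ℕ} (hi : 1 ≤ i) (hik : i ≤ k) {r D a σ : ℝ} (hr : 2 ≤ r)
    (hD : 0 < D) (hσ : 0 ≤ σ) (hσa : σ ≤ a) :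
    ((k : ℝ) / momentScale r D a k ^ r) ^ i *
        (2 * (Real.sqrt (r * i) * σ) ^ (r * i)) / (i.factorial : ℝ) ≤
      2 * k * (1 / 4) ^ i * (σ ^ r / D ^ r) := by
  have ha : 0 ≤ a := hσ.trans hσa
  have hi0 : (0 : ℝ) < i := by exact_mod_cast hi
  have hik' : (i : ℝ) ≤ k := by exact_mod_cast hik
  have hk0 : (0 : ℝ) < k := hi0.trans_le hik'
  have hr0 : 0 < r := by linarith
  set G : ℝ := (2 * Real.exp 1) ^ r with hG
  have hG0 : 0 < G := by positivity
  have hG4 : 4 * Real.exp (r / 2) ≤ G := by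
    rw [hG, Real.mul_rpow (by norm_num) (Real.exp_pos 1).le, ← Real.exp_mul, one_mul]
    have h4 : (4 : ℝ) ≤ 2 ^ r := by
      calc (4 : ℝ) = 2 ^ (2 : ℝ) := by norm_num
        _ ≤ 2 ^ r := Real.rpow_le_rpow_of_exponent_le (by norm_num) hr
    have h5 : Real.exp (r / 2) ≤ Real.exp r := Real.exp_le_exp.mpr (by linarith)
    gcongr
  have hB := Real.rpow_pos_of_pos (momentScale_pos hr hD ha k) r
  set B : ℝ := momentScale r D a k ^ r with hBdef
  have hB1 : G * r ^ (r / 2) * D ^ r ≤ B := by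
    rw [hG, ← sqrt_rpow_eq hr0.le, ← Real.mul_rpow (by positivity) (by positivity),
      ← Real.mul_rpow (by positivity) (by positivity), hBdef]
    unfold momentScale
    gcongr
    exact le_add_of_nonneg_right (by positivity)
  have hB2 : G * r ^ (r / 2) * ((k : ℝ) ^ (r / 2) * a ^ r) ≤ B := by
    rw [hG, ← sqrt_rpow_eq hr0.le, ← sqrt_rpow_eq hk0.le,
      ← Real.mul_rpow (by positivity) (by positivity),
      ← Real.mul_rpow (by positivity) (by positivity),
      ← Real.mul_rpow (by positivity) (by positivity), hBdef]
    unfold momentScale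
    gcongr
    exact le_add_of_nonneg_left hD.le
  have hpow : (Real.sqrt (r * i) * σ) ^ (r * i) =
      (r ^ (r / 2) * (i : ℝ) ^ (r / 2) * σ ^ r) ^ i := by
    rw [Real.rpow_mul (by positivity), Real.rpow_natCast,
      Real.mul_rpow (by positivity) hσ, sqrt_rpow_eq (by positivity),
      Real.mul_rpow hr0.le hi0.le]
  rw [hpow]
  have hN := pow_mul_rpow_pow_div_factorial_le hi hik (ρ := r / 2) (by linarith)
  obtain ⟨l, rfl⟩ : ∃ l, i = l + 1 := ⟨i - 1, by omega⟩
  simp only [Nat.add_sub_cancel] at hN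
  set I : ℝ := ((l + 1 : ℕ) : ℝ) ^ (r / 2)
  set R : ℝ := r ^ (r / 2)
  set P : ℝ := (k : ℝ) ^ (r / 2)
  set s : ℝ := σ ^ r
  set d : ℝ := D ^ r
  have hd : 0 < d := Real.rpow_pos_of_pos hD r
  have hs : 0 ≤ s := Real.rpow_nonneg hσ r
  have hsa : s ≤ a ^ r := Real.rpow_le_rpow hσ hσa hr0.le
  have hR : 0 < R := Real.rpow_pos_of_pos hr0 _
  have hP : 0 < P := Real.rpow_pos_of_pos hk0 _
  have hBpow : G ^ (l + 1) * R ^ (l + 1) * d * (P * s) ^ l ≤ B ^ (l + 1) := by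
    calc G ^ (l + 1) * R ^ (l + 1) * d * (P * s) ^ l
        = (G * R * (P * s)) ^ l * (G * R * d) := by ring
      _ ≤ (G * R * (P * a ^ r)) ^ l * (G * R * d) := by gcongr
      _ ≤ B ^ l * B := by gcongr
      _ = B ^ (l + 1) := by ring
  have hkey : (k : ℝ) ^ (l + 1) * I ^ (l + 1) / ((l + 1).factorial : ℝ) ≤
      k * (G / 4) ^ (l + 1) * P ^ l := by
    refine hN.trans ?_
    gcongr
    linarith
  calc ((k : ℝ) / B) ^ (l + 1) * (2 * (R * I * s) ^ (l + 1)) / ((l + 1).factorial : ℝ)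
      = 2 * ((k : ℝ) ^ (l + 1) * I ^ (l + 1) / ((l + 1).factorial : ℝ)) *
          (R ^ (l + 1) * s ^ (l + 1)) / B ^ (l + 1) := by
        rw [div_pow]; ring
    _ ≤ 2 * (k * (G / 4) ^ (l + 1) * P ^ l) * (R ^ (l + 1) * s ^ (l + 1)) / B ^ (l + 1) := by
        gcongr
    _ = 2 * k * (1 / 4) ^ (l + 1) * (s / d) *
          (G ^ (l + 1) * R ^ (l + 1) * d * (P * s) ^ l / B ^ (l + 1)) := by
        field_simp
        rw [div_pow, div_pow, one_pow]
        ring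
    _ ≤ 2 * k * (1 / 4) ^ (l + 1) * (s / d) * 1 := by
        gcongr
        exact (div_le_one (by positivity)).mpr hBpow
    _ = _ := mul_one _

theorem integrable_truncExp_abs_rpow {Ω : Type*} {mΩ : MeasurableSpace Ω} {ν : Measure Ω}
    [IsProbabilityMeasure ν] {X : Ω → ℝ} {c : ℝ≥0} (h : HasSubgaussianMGF X c ν) (k : ℕ)
    {r : ℝ} (hr : 0 < r) (x : ℝ) :
    Integrable (fun ω => truncExp k (x * |X ω| ^ r)) ν := by
  unfold truncExp
  refine integrable_finsetSum _ fun i _ => Integrable.div_const ?_ _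
  simp_rw [mul_pow, ← Real.rpow_natCast (|X _| ^ r), ← Real.rpow_mul (abs_nonneg _)]
  refine Integrable.const_mul ?_ _
  rcases Nat.eq_zero_or_pos i with rfl | hi
  · simp
  · exact integrable_abs_rpow_of_subgaussian h (mul_pos hr (by exact_mod_cast hi))

theorem integral_truncExp_abs_rpow_le {Ω : Type*} {mΩ : MeasurableSpace Ω} {ν : Measure Ω}
    [IsProbabilityMeasure ν] {X : Ω → ℝ} {c : ℝ≥0} (h : HasSubgaussianMGF X c ν) (k : ℕ)
    {r D a : ℝ} (hr : 2 ≤ r) (hD : 0 < D) (hca : Real.sqrt c ≤ a) :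
    ∫ ω, truncExp k ((k / momentScale r D a k ^ r) * |X ω| ^ r) ∂ν ≤
      Real.exp (k * (Real.sqrt c ^ r / D ^ r)) := by
  have hr0 : 0 < r := by linarith
  set x : ℝ := k / momentScale r D a k ^ r with hx
  have ha : 0 ≤ a := (Real.sqrt_nonneg _).trans hca
  have hx0 : 0 ≤ x := div_nonneg (by positivity)
    (Real.rpow_nonneg (momentScale_pos hr hD ha k).le _)
  have h_intble : ∀ i : ℕ, 1 ≤ i → Integrable (fun ω => |X ω| ^ (r * i)) ν := fun i hi =>
    integrable_abs_rpow_of_subgaussian h (mul_pos hr0 (by exact_mod_cast hi))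
  have hexp : ∀ ω, truncExp k (x * |X ω| ^ r) =
      ∑ i ∈ Finset.range k, x ^ (i + 1) / ((i + 1).factorial : ℝ) *
        |X ω| ^ (r * ((i + 1 : ℕ) : ℝ)) + 1 := by
    intro ω
    unfold truncExp
    rw [Finset.sum_range_succ']
    simp only [pow_zero, Nat.factorial_zero, Nat.cast_one, div_one]
    congr 1
    refine Finset.sum_congr rfl fun i _ => ?_
    rw [mul_pow, Real.rpow_mul (abs_nonneg _), Real.rpow_natCast]
    ring
  simp_rw [hexp]
  rw [integral_add (integrable_finsetSum _ fun i _ =>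
      (h_intble (i + 1) (by omega)).const_mul _) (integrable_const _),
    integral_finsetSum _ fun i _ => (h_intble (i + 1) (by omega)).const_mul _]
  simp_rw [integral_const_mul]
  have hterm : ∀ i ∈ Finset.range k, x ^ (i + 1) / ((i + 1).factorial : ℝ) *
      ∫ ω, |X ω| ^ (r * ((i + 1 : ℕ) : ℝ)) ∂ν ≤
      2 * k * (1 / 4) ^ (i + 1) * (Real.sqrt c ^ r / D ^ r) := by
    intro i hi
    refine le_trans ?_ (moment_term_le (i := i + 1) (by omega) (Finset.mem_range.mp hi) hr hD
      (Real.sqrt_nonneg c) hca)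
    rw [← hx, mul_div_right_comm]
    gcongr
    exact integral_abs_rpow_le_of_subgaussian h
      (mul_pos hr0 (by exact_mod_cast Nat.succ_pos i))
  have hgeom : ∑ i ∈ Finset.range k, (1 / 4 : ℝ) ^ (i + 1) ≤ 1 / 2 := by
    have : ∀ j : ℕ, ∑ i ∈ Finset.range j, (1 / 4 : ℝ) ^ (i + 1) = 1 / 3 - 1 / 3 * (1 / 4) ^ j := by
      intro j
      induction j with
      | zero => simp
      | succ j ih => rw [Finset.sum_range_succ, ih]; ring
    rw [this]
    have : (0 : ℝ) ≤ (1 / 4) ^ k := by positivity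
    linarith
  have hq : 0 ≤ Real.sqrt c ^ r / D ^ r := by positivity
  calc _ ≤ ∑ i ∈ Finset.range k, 2 * k * (1 / 4) ^ (i + 1) * (Real.sqrt c ^ r / D ^ r) + 1 := by
        simp only [integral_const, probReal_univ, smul_eq_mul, mul_one]
        exact add_le_add_left (Finset.sum_le_sum hterm) 1
    _ = 2 * k * (∑ i ∈ Finset.range k, (1 / 4 : ℝ) ^ (i + 1)) * (Real.sqrt c ^ r / D ^ r) + 1 := by
        rw [Finset.mul_sum, Finset.sum_mul]
    _ ≤ 2 * k * (1 / 2) * (Real.sqrt c ^ r / D ^ r) + 1 := by gcongr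
    _ = k * (Real.sqrt c ^ r / D ^ r) + 1 := by ring
    _ ≤ _ := Real.add_one_le_exp _

theorem moment_sum_abs_rpow {Ω κ : Type*} [Fintype κ] {mΩ : MeasurableSpace Ω} {ν : Measure Ω}
    [IsProbabilityMeasure ν] {X : κ → Ω → ℝ} (hX : ∀ j, Measurable (X j)) {c : κ → ℝ≥0}
    (h : ∀ j, HasSubgaussianMGF (X j) (c j) ν) {k : ℕ} (hk : 1 ≤ k)
    {r D a : ℝ} (hr : 2 ≤ r) (hD : 0 < D) (ha : 0 ≤ a) (hca : ∀ j, Real.sqrt (c j) ≤ a)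
    (hcD : ∑ j, Real.sqrt (c j) ^ r ≤ D ^ r) :
    Integrable (fun y : κ → Ω => (∑ j, |X j (y j)| ^ r) ^ k) (Measure.pi fun _ => ν) ∧
    ∫ y : κ → Ω, (∑ j, |X j (y j)| ^ r) ^ k ∂(Measure.pi fun _ => ν) ≤
      (Real.exp 1 * momentScale r D a k ^ r) ^ k := by
  have hr0 : 0 < r := by linarith
  have hk0 : (0 : ℝ) < k := by exact_mod_cast hk
  have hB := Real.rpow_pos_of_pos (momentScale_pos hr hD ha k) r
  set B : ℝ := momentScale r D a k ^ r with hBdef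
  have hx0 : 0 < k / B := by positivity
  have hpt : ∀ y : κ → Ω, (∑ j, |X j (y j)| ^ r) ^ k ≤
      (B / k) ^ k * k.factorial * ∏ j, truncExp k (k / B * |X j (y j)| ^ r) := by
    intro y
    have h1 := pow_le_prod_truncExp k Finset.univ (z := fun j => k / B * |X j (y j)| ^ r)
      fun j => by positivity
    rw [← Finset.mul_sum, mul_pow] at h1
    have h2 := mul_le_mul_of_nonneg_left h1 (show 0 ≤ (B / k) ^ k by positivity)
    rw [← mul_assoc, ← mul_pow, div_mul_div_cancel₀ hk0.ne', div_self hB.ne', one_pow, one_mul]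
      at h2
    linarith
  have hprod : Integrable (fun y : κ → Ω => (B / k) ^ k * k.factorial *
      ∏ j, truncExp k (k / B * |X j (y j)| ^ r)) (Measure.pi fun _ => ν) :=
    (Integrable.fintype_prod (f := fun j ω => truncExp k (k / B * |X j ω| ^ r)) fun j =>
      integrable_truncExp_abs_rpow (h j) k hr0 _).const_mul _
  have hI : Integrable (fun y : κ → Ω => (∑ j, |X j (y j)| ^ r) ^ k) (Measure.pi fun _ => ν) := by
    refine hprod.mono' ?_ (ae_of_all _ fun y => ?_)
    · refine Measurable.aestronglyMeasurable ?_
      refine Measurable.pow_const (Finset.measurable_fun_sum _ fun j _ => ?_) _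
      have : Measurable fun y : κ → Ω => X j (y j) := (hX j).comp (measurable_pi_apply j)
      exact (measurable_norm.comp this).pow_const r
    · rw [Real.norm_of_nonneg (pow_nonneg (Finset.sum_nonneg fun j _ => by positivity) k)]
      exact hpt y
  refine ⟨hI, (integral_mono hI hprod hpt).trans ?_⟩
  rw [integral_const_mul,
    integral_fintype_prod_eq_prod (fun j ω => truncExp k (k / B * |X j ω| ^ r))]
  have h3 : ∏ j, ∫ ω, truncExp k (k / B * |X j ω| ^ r) ∂ν ≤ Real.exp 1 ^ k := by
    calc ∏ j, ∫ ω, truncExp k (k / B * |X j ω| ^ r) ∂ν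
        ≤ ∏ j, Real.exp (k * (Real.sqrt (c j) ^ r / D ^ r)) :=
          Finset.prod_le_prod (fun j _ => integral_nonneg fun ω =>
              zero_le_one.trans (one_le_truncExp k (by positivity)))
            fun j _ => integral_truncExp_abs_rpow_le (h j) k hr hD (hca j)
      _ = Real.exp (k * ((∑ j, Real.sqrt (c j) ^ r) / D ^ r)) := by
          rw [← Real.exp_sum, Finset.sum_div, Finset.mul_sum]
      _ ≤ Real.exp (k * 1) := by
          gcongr
          exact (div_le_one (Real.rpow_pos_of_pos hD r)).mpr hcD
      _ = _ := Real.exp_nat_mul 1 k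
  calc (B / k) ^ k * k.factorial * ∏ j, ∫ ω, truncExp k (k / B * |X j ω| ^ r) ∂ν
      ≤ (B / k) ^ k * (k : ℝ) ^ k * Real.exp 1 ^ k := by
        have h4 : 0 ≤ ∏ j, ∫ ω, truncExp k (k / B * |X j ω| ^ r) ∂ν :=
          Finset.prod_nonneg fun j _ => integral_nonneg fun ω =>
            zero_le_one.trans (one_le_truncExp k (by positivity))
        have h5 : (k.factorial : ℝ) ≤ (k : ℝ) ^ k := by exact_mod_cast Nat.factorial_le_pow k
        gcongr
    _ = (Real.exp 1 * B) ^ k := by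
        rw [← mul_pow, ← mul_pow, div_mul_cancel₀ _ hk0.ne', mul_comm]

/-- The integer vectors reached from `0` by `K` successive changes of one coordinate to a value
in `[-m, m]`. -/
def gridNet (m : ℕ) : ℕ → Finset (Fin m → ℤ)
  | 0 => {0}
  | K + 1 => (gridNet m K ×ˢ (Finset.univ ×ˢ Finset.Icc (-(m : ℤ)) m)).image
      fun x => Function.update x.1 x.2.1 x.2.2

theorem card_gridNet_le (m K : ℕ) : (gridNet m K).card ≤ (m * (2 * m + 1)) ^ K := by
  induction K with
  | zero => simp [gridNet]
  | succ K ih =>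
    rw [gridNet, pow_succ]
    refine Finset.card_image_le.trans ?_
    rw [Finset.card_product, Finset.card_product, Finset.card_univ, Fintype.card_fin,
      Int.card_Icc]
    have : ((m : ℤ) + 1 - -(m : ℤ)).toNat = 2 * m + 1 := by omega
    rw [this]
    gcongr

theorem mem_gridNet {m : ℕ} (hm : 0 < m) {K : ℕ} {z : Fin m → ℤ} (hz : ∀ i, |z i| ≤ m)
    (hcard : (Finset.univ.filter fun i => z i ≠ 0).card ≤ K) : z ∈ gridNet m K := by
  classical
  induction K generalizing z with
  | zero =>
    rw [Nat.le_zero, Finset.card_eq_zero, Finset.filter_eq_empty_iff] at hcard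
    simp only [gridNet, Finset.mem_singleton]
    ext i
    simpa using hcard (Finset.mem_univ i)
  | succ K ih =>
    obtain ⟨i, hi⟩ : ∃ i : Fin m,
        (Finset.univ.filter fun j => Function.update z i 0 j ≠ 0).card ≤ K := by
      rcases (Finset.univ.filter fun i => z i ≠ 0).eq_empty_or_nonempty with h | ⟨i, hi⟩
      · refine ⟨⟨0, hm⟩, ?_⟩
        rw [Finset.filter_eq_empty_iff] at h
        rw [Finset.card_eq_zero.mpr]
        · exact Nat.zero_le K
        · refine Finset.filter_eq_empty_iff.mpr fun j hj => ?_
          rw [Function.update_apply]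
          split_ifs
          · simp
          · exact h hj
      · refine ⟨i, ?_⟩
        have : (Finset.univ.filter fun j => Function.update z i 0 j ≠ 0) ⊆
            (Finset.univ.filter fun i => z i ≠ 0).erase i := by
          intro j hj
          simp only [Finset.mem_filter, Finset.mem_univ, true_and, Function.update_apply] at hj
          split_ifs at hj with h
          · exact absurd rfl hj
          · simp [h, hj]
        have h2 := Finset.card_le_card this
        rw [Finset.card_erase_of_mem hi] at h2
        omega
    rw [gridNet, Finset.mem_image]
    refine ⟨(Function.update z i 0, i, z i), ?_, by simp⟩
    simp only [Finset.mem_product, Finset.mem_univ, true_and, Finset.mem_Icc]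
    refine ⟨ih (fun j => ?_) hi, abs_le.mp (hz i)⟩
    rw [Function.update_apply]
    split_ifs
    · simp
    · exact hz j

theorem exists_int_div_approx {m : ℕ} (hm : 0 < m) (x : ℝ) :
    ∃ z : ℤ, |(z : ℝ) / m| ≤ |x| ∧ |x - z / m| ≤ 1 / m := by
  have hm0 : (0 : ℝ) < m := by exact_mod_cast hm
  have key : ∀ y : ℝ, 0 ≤ y → ∃ z : ℤ, 0 ≤ (z : ℝ) / m ∧ (z : ℝ) / m ≤ y ∧ y - z / m ≤ 1 / m := by
    intro y hy
    have h1 := Int.floor_le (m * y)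
    have h2 := Int.lt_floor_add_one (m * y)
    have h3 : (0 : ℝ) ≤ ⌊m * y⌋ := by
      exact_mod_cast Int.floor_nonneg.mpr (mul_nonneg hm0.le hy)
    refine ⟨⌊m * y⌋, by positivity, ?_, ?_⟩
    · rw [div_le_iff₀ hm0]; linarith
    · rw [sub_le_iff_le_add, ← add_div, le_div_iff₀ hm0]; linarith
  rcases le_total 0 x with hx | hx
  · obtain ⟨z, h0, h1, h2⟩ := key x hx
    refine ⟨z, by rwa [abs_of_nonneg h0, abs_of_nonneg hx], ?_⟩
    rwa [abs_of_nonneg (by linarith)]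
  · obtain ⟨z, h0, h1, h2⟩ := key (-x) (by linarith)
    refine ⟨-z, ?_, ?_⟩
    · push_cast
      rw [neg_div, abs_neg, abs_of_nonneg h0, abs_of_nonpos hx]
      exact h1
    · push_cast
      rw [neg_div, sub_neg_eq_add, abs_of_nonpos (by linarith)]
      linarith

/-- The points of `gridNet`, rescaled by `1 / m`, which lie in the Euclidean unit ball. -/
def ballNet (m K : ℕ) : Finset (Fin m → ℝ) :=
  ((gridNet m K).image fun z i => (z i : ℝ) / m).filter fun v => ∑ i, v i ^ 2 ≤ 1

theorem card_ballNet_le (m K : ℕ) : (ballNet m K).card ≤ (m * (2 * m + 1)) ^ K :=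
  (Finset.card_filter_le _ _).trans (Finset.card_image_le.trans (card_gridNet_le m K))

theorem mem_ballNet {m : ℕ} (hm : 0 < m) {K : ℕ} {z : Fin m → ℤ}
    (hball : ∑ i, ((z i : ℝ) / m) ^ 2 ≤ 1)
    (hcard : (Finset.univ.filter fun i => z i ≠ 0).card ≤ K) :
    (fun i => (z i : ℝ) / m) ∈ ballNet m K := by
  have hm0 : (0 : ℝ) < m := by exact_mod_cast hm
  refine Finset.mem_filter.mpr ⟨Finset.mem_image_of_mem _ (mem_gridNet hm (fun i => ?_) hcard),
    hball⟩
  have h1 : ((z i : ℝ) / m) ^ 2 ≤ 1 :=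
    (Finset.single_le_sum (f := fun i => ((z i : ℝ) / m) ^ 2) (fun j _ => sq_nonneg _)
      (Finset.mem_univ i)).trans hball
  have h2 := (sq_le_one_iff_abs_le_one _).mp h1
  rw [abs_div, abs_of_pos hm0, div_le_one hm0] at h2
  exact_mod_cast h2

theorem single_mem_ballNet {m : ℕ} (hm : 0 < m) {K : ℕ} (hK : 1 ≤ K) (i : Fin m) {ε : ℤ}
    (hε : |ε| = 1) : (fun j => if j = i then (ε : ℝ) else 0) ∈ ballNet m K := by
  have hm0 : (0 : ℝ) < m := by exact_mod_cast hm
  have heq : (fun j => if j = i then (ε : ℝ) else 0) =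
      fun j => (((if j = i then ε * m else 0 : ℤ)) : ℝ) / m := by
    ext j
    split_ifs
    · push_cast
      field_simp
    · simp
  have hsq : (ε : ℝ) ^ 2 = 1 := by
    have : ε ^ 2 = 1 := by rw [← sq_abs, hε, one_pow]
    exact_mod_cast this
  rw [heq]
  refine mem_ballNet hm ?_ ?_
  · have h3 : ∀ j, (((if j = i then ε * m else 0 : ℤ)) : ℝ) / m = if j = i then (ε : ℝ) else 0 :=
      fun j => (congrFun heq j).symm
    simp_rw [h3]
    simp [hsq]
  · refine le_trans (Finset.card_le_card (t := {i}) fun j hj => ?_) (by simpa using hK)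
    by_contra h
    rw [Finset.mem_singleton] at h
    simp [h] at hj

theorem bilinear_le_of_ballNet {m n K : ℕ} (hm : 0 < m) (hK : 1 ≤ K) {p r : ℝ}
    (hpr : r.HolderConjugate p) (W : Fin m → Fin n → ℝ) {M : ℝ}
    (hM : ∀ v ∈ ballNet m K, (∑ j, |∑ i, W i j * v i| ^ r) ^ (1 / r) ≤ M)
    {s : Fin m → ℝ} (hs : ∑ i, s i ^ 2 ≤ 1)
    (hcard : (Finset.univ.filter fun i => s i ≠ 0).card ≤ K)
    {t : Fin n → ℝ} (ht : (∑ j, |t j| ^ p) ^ (1 / p) ≤ 1) :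
    ∑ i, s i * ∑ j, W i j * t j ≤ 2 * M := by
  have hm0 : (0 : ℝ) < m := by exact_mod_cast hm
  have hβ : ∀ v ∈ ballNet m K, ∑ i, v i * ∑ j, W i j * t j ≤ M := by
    intro v hv
    calc ∑ i, v i * ∑ j, W i j * t j = ∑ j, (∑ i, W i j * v i) * t j := by
          simp_rw [Finset.mul_sum, Finset.sum_mul]
          rw [Finset.sum_comm]
          refine Finset.sum_congr rfl fun j _ => Finset.sum_congr rfl fun i _ => by ring
      _ ≤ (∑ j, |∑ i, W i j * v i| ^ r) ^ (1 / r) * (∑ j, |t j| ^ p) ^ (1 / p) :=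
          Real.inner_le_Lp_mul_Lq _ _ _ hpr
      _ ≤ M * 1 := by
          refine mul_le_mul (hM v hv) ht (by positivity) (le_trans (by positivity) (hM v hv))
      _ = M := mul_one M
  have hrow : ∀ i, |∑ j, W i j * t j| ≤ M := by
    intro i
    have h1 := hβ _ (single_mem_ballNet hm hK i (ε := 1) (by simp))
    have h2 := hβ _ (single_mem_ballNet hm hK i (ε := -1) (by simp))
    simp only [ite_mul, zero_mul, Finset.sum_ite_eq', Finset.mem_univ, if_true] at h1 h2
    push_cast at h1 h2
    exact abs_le'.mpr ⟨by linarith, by linarith⟩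
  have hM0 : 0 ≤ M := (abs_nonneg _).trans (hrow ⟨0, hm⟩)
  choose z hz1 hz2 using fun i => exists_int_div_approx hm (s i)
  have hzmem : (fun i => (z i : ℝ) / m) ∈ ballNet m K := by
    refine mem_ballNet hm (le_trans (Finset.sum_le_sum fun i _ => sq_le_sq.mpr (hz1 i)) hs) ?_
    refine (Finset.card_le_card fun i hi => ?_).trans hcard
    simp only [Finset.mem_filter, Finset.mem_univ, true_and] at hi ⊢
    intro h0
    have := hz1 i
    rw [h0, abs_zero, abs_nonpos_iff, div_eq_zero_iff] at this
    rcases this with h | h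
    · exact hi (by exact_mod_cast h)
    · exact hm0.ne' h
  calc ∑ i, s i * ∑ j, W i j * t j
      = ∑ i, (z i : ℝ) / m * ∑ j, W i j * t j + ∑ i, (s i - z i / m) * ∑ j, W i j * t j := by
        rw [← Finset.sum_add_distrib]
        refine Finset.sum_congr rfl fun i _ => by ring
    _ ≤ M + ∑ _i : Fin m, 1 / (m : ℝ) * M := by
        refine add_le_add (hβ _ hzmem) (Finset.sum_le_sum fun i _ => ?_)
        refine (le_abs_self _).trans ?_
        rw [abs_mul]
        exact mul_le_mul (hz2 i) (hrow i) (abs_nonneg _) (by positivity)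
    _ = 2 * M := by
        rw [Finset.sum_const, Finset.card_univ, Fintype.card_fin, nsmul_eq_mul]
        field_simp
        ring

theorem moment_column_sums {m n : ℕ} (A : Fin m → Fin n → ℝ) {k : ℕ} (hk : 1 ≤ k)
    {r D a : ℝ} (hr : 2 ≤ r) (hD : 0 < D) (ha : 0 ≤ a) (hAa : ∀ i j, |A i j| ≤ a)
    (hAD : ∀ i, ∑ j, |A i j| ^ r ≤ D ^ r) {v : Fin m → ℝ} (hv : ∑ i, v i ^ 2 ≤ 1) :
    Integrable (fun g : Fin m × Fin n → ℝ => (∑ j, |∑ i, A i j * g (i, j) * v i| ^ r) ^ k)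
      (stdGaussian (Fin m × Fin n)) ∧
    ∫ g : Fin m × Fin n → ℝ, (∑ j, |∑ i, A i j * g (i, j) * v i| ^ r) ^ k
      ∂stdGaussian (Fin m × Fin n) ≤ (Real.exp 1 * momentScale r D a k ^ r) ^ k := by
  have hr0 : 0 < r := by linarith
  have hc : ∀ j, ((∑ i, ((A i j * v i) ^ 2).toNNReal : ℝ≥0) : ℝ) = ∑ i, v i ^ 2 * A i j ^ 2 := by
    intro j
    rw [NNReal.coe_sum]
    refine Finset.sum_congr rfl fun i _ => ?_
    rw [Real.coe_toNNReal _ (sq_nonneg _)]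
    ring
  have hca : ∀ j, Real.sqrt ((∑ i, ((A i j * v i) ^ 2).toNNReal : ℝ≥0) : ℝ) ≤ a := by
    intro j
    rw [hc, Real.sqrt_le_left ha]
    calc ∑ i, v i ^ 2 * A i j ^ 2 ≤ ∑ i, v i ^ 2 * a ^ 2 := by
          refine Finset.sum_le_sum fun i _ => mul_le_mul_of_nonneg_left ?_ (sq_nonneg _)
          rw [← sq_abs (A i j)]
          exact pow_le_pow_left₀ (abs_nonneg _) (hAa i j) 2
      _ = (∑ i, v i ^ 2) * a ^ 2 := by rw [Finset.sum_mul]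
      _ ≤ 1 * a ^ 2 := by gcongr
      _ = a ^ 2 := one_mul _
  have hcD : ∑ j, Real.sqrt ((∑ i, ((A i j * v i) ^ 2).toNNReal : ℝ≥0) : ℝ) ^ r ≤ D ^ r := by
    have h1 : ∀ j, Real.sqrt ((∑ i, ((A i j * v i) ^ 2).toNNReal : ℝ≥0) : ℝ) ^ r ≤
        ∑ i, v i ^ 2 * |A i j| ^ r := by
      intro j
      rw [sqrt_rpow_eq (NNReal.coe_nonneg _), hc]
      have hρ : 1 ≤ r / 2 := by linarith
      have h2 := Real.inner_le_weight_mul_Lp_of_nonneg Finset.univ hρ (fun i => v i ^ 2)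
        (fun i => A i j ^ 2) (fun i => sq_nonneg _) (fun i => sq_nonneg _)
      have h3 : (∑ i, v i ^ 2) ^ (1 - (r / 2)⁻¹) ≤ 1 :=
        Real.rpow_le_one (Finset.sum_nonneg fun i _ => sq_nonneg _) hv
          (sub_nonneg.mpr (inv_le_one_of_one_le₀ hρ))
      have h4 : ∀ i, (A i j ^ 2) ^ (r / 2) = |A i j| ^ r := by
        intro i
        rw [← sq_abs, ← Real.rpow_natCast, ← Real.rpow_mul (abs_nonneg _)]
        congr 1
        push_cast
        ring
      simp_rw [h4] at h2
      have h5 : 0 ≤ ∑ i, v i ^ 2 * |A i j| ^ r := Finset.sum_nonneg fun i _ => by positivity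
      have h6 := h2.trans (mul_le_of_le_one_left (by positivity) h3)
      calc (∑ i, v i ^ 2 * A i j ^ 2) ^ (r / 2)
          ≤ ((∑ i, v i ^ 2 * |A i j| ^ r) ^ (r / 2)⁻¹) ^ (r / 2) :=
            Real.rpow_le_rpow (Finset.sum_nonneg fun i _ => by positivity) h6 (by linarith)
        _ = _ := Real.rpow_inv_rpow h5 (by linarith)
    calc _ ≤ ∑ j, ∑ i, v i ^ 2 * |A i j| ^ r := Finset.sum_le_sum fun j _ => h1 j
      _ = ∑ i, v i ^ 2 * ∑ j, |A i j| ^ r := by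
          rw [Finset.sum_comm]
          simp_rw [Finset.mul_sum]
      _ ≤ ∑ i, v i ^ 2 * D ^ r :=
          Finset.sum_le_sum fun i _ => mul_le_mul_of_nonneg_left (hAD i) (sq_nonneg _)
      _ = (∑ i, v i ^ 2) * D ^ r := by rw [Finset.sum_mul]
      _ ≤ 1 * D ^ r := by gcongr
      _ = D ^ r := one_mul _
  have hmain := moment_sum_abs_rpow (ν := stdGaussian (Fin m))
    (X := fun j x => ∑ i, A i j * v i * x i) (fun j => by fun_prop)
    (fun j => hasSubgaussianMGF_linear fun i => A i j * v i) hk hr hD ha hca hcD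
  have hswap : ∀ (g : Fin m × Fin n → ℝ) j,
      ∑ i, A i j * g (i, j) * v i = ∑ i, A i j * v i * g (i, j) := fun g j =>
    Finset.sum_congr rfl fun i _ => by ring
  simp_rw [hswap]
  have hmeas : Measurable fun g : Fin m × Fin n → ℝ =>
      (∑ j, |∑ i, A i j * v i * g (i, j)| ^ r) ^ k := by
    refine Measurable.pow_const (Finset.measurable_fun_sum _ fun j _ => ?_) _
    have : Measurable fun g : Fin m × Fin n → ℝ => ∑ i, A i j * v i * g (i, j) := by fun_prop
    exact (measurable_norm.comp this).pow_const r
  have hu : Measurable fun (y : Fin n → Fin m → ℝ) (ij : Fin m × Fin n) => y ij.2 ij.1 := by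
    fun_prop
  rw [← map_uncurry_stdGaussian, integral_map hu.aemeasurable hmeas.aestronglyMeasurable,
    integrable_map_measure hmeas.aestronglyMeasurable hu.aemeasurable]
  exact hmain

theorem sum_sq_truncation_le {m : ℕ} {u γ : ℝ} (hu : 1 ≤ u) (hu2 : u ≤ 2) {s : Fin m → ℝ}
    (hs : ∑ i, |s i| ^ u ≤ 1) : ∑ i, (if γ⁻¹ ≤ |s i| then s i else 0) ^ 2 ≤ 1 := by
  refine le_trans (Finset.sum_le_sum fun i _ => ?_) hs
  have hu0 : 0 < u := by linarith
  have h1 : |s i| ^ u ≤ 1 := (Finset.single_le_sum (f := fun i => |s i| ^ u)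
    (fun j _ => Real.rpow_nonneg (abs_nonneg _) _) (Finset.mem_univ i)).trans hs
  have h2 : |s i| ≤ 1 := by
    by_contra! h
    exact absurd h1 (not_le.mpr (Real.one_lt_rpow h hu0))
  split_ifs
  · rcases (abs_nonneg (s i)).eq_or_lt with h0 | h0
    · rw [abs_eq_zero.mp h0.symm]
      simp [Real.zero_rpow hu0.ne']
    · rw [← sq_abs, ← Real.rpow_natCast]
      exact Real.rpow_le_rpow_of_exponent_ge h0 h2 (by exact_mod_cast hu2)
  · rw [zero_pow two_ne_zero]
    positivity

theorem card_truncation_le {m : ℕ} {u γ : ℝ} (hu : 1 ≤ u) (hγ : 1 ≤ γ) {s : Fin m → ℝ}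
    (hs : ∑ i, |s i| ^ u ≤ 1) :
    (Finset.univ.filter fun i => (if γ⁻¹ ≤ |s i| then s i else 0) ≠ 0).card ≤ ⌊γ ^ u⌋₊ := by
  have hγ0 : 0 < γ := by linarith
  refine Nat.le_floor ?_
  set S := Finset.univ.filter fun i => (if γ⁻¹ ≤ |s i| then s i else 0) ≠ 0
  have h1 : ∑ i ∈ S, (γ ^ u)⁻¹ ≤ 1 := by
    calc ∑ i ∈ S, (γ ^ u)⁻¹ ≤ ∑ i ∈ S, |s i| ^ u := by
          refine Finset.sum_le_sum fun i hi => ?_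
          have h : γ⁻¹ ≤ |s i| := by
            by_contra h
            simp [S, h] at hi
          rw [← Real.inv_rpow hγ0.le]
          exact Real.rpow_le_rpow (by positivity) h (by linarith)
      _ ≤ ∑ i, |s i| ^ u :=
          Finset.sum_le_sum_of_subset_of_nonneg (Finset.subset_univ _) fun i _ _ => by positivity
      _ ≤ 1 := hs
  rw [Finset.sum_const, nsmul_eq_mul, ← div_eq_mul_inv, div_le_one (by positivity)] at h1
  exact h1

theorem rpow_le_mul_one_add_pow_div {S R r : ℝ} {k : ℕ} (hS : 0 ≤ S) (hR : 0 < R) (hr : 1 ≤ r)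
    (hk : 1 ≤ k) : S ^ (1 / r) ≤ R * (1 + S ^ k / (R ^ r) ^ k) := by
  have hr0 : 0 < r := by linarith
  have h0 : 0 ≤ S ^ k / (R ^ r) ^ k := by positivity
  rcases le_total (S ^ (1 / r)) R with h | h
  · nlinarith
  · have h1 : 1 ≤ S ^ (1 / r) / R := (one_le_div hR).mpr h
    have h2 : (S ^ (1 / r) / R) ^ r = S / R ^ r := by
      rw [Real.div_rpow (by positivity) hR.le, ← Real.rpow_mul hS, one_div_mul_cancel hr0.ne',
        Real.rpow_one]
    have h3 : S ^ (1 / r) / R ≤ (S / R ^ r) ^ k := by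
      calc S ^ (1 / r) / R ≤ (S ^ (1 / r) / R) ^ r := Real.self_le_rpow_of_one_le h1 hr
        _ = S / R ^ r := h2
        _ ≤ (S / R ^ r) ^ k :=
          le_self_pow₀ (h2 ▸ Real.one_le_rpow h1 hr0.le) (by omega)
    rw [div_pow, div_le_iff₀ hR] at h3
    nlinarith

theorem integral_sSup_le {m n K k : ℕ} (hm : 0 < m) (hK : 1 ≤ K) (hk : 1 ≤ k)
    (A : Fin m → Fin n → ℝ) {p r D a : ℝ} (hpr : r.HolderConjugate p) (hr : 2 ≤ r) (hD : 0 < D)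
    (ha : 0 ≤ a) (hAa : ∀ i j, |A i j| ≤ a) (hAD : ∀ i, ∑ j, |A i j| ^ r ≤ D ^ r)
    (hcard : ((ballNet m K).card : ℝ) ≤ Real.exp (r * k))
    {T : (Fin m × Fin n → ℝ) → Set ℝ} (hT0 : ∀ g, 0 ∈ T g)
    (hT : ∀ g, ∀ x ∈ T g, ∃ s : Fin m → ℝ, ∃ t : Fin n → ℝ, ∑ i, s i ^ 2 ≤ 1 ∧
      (Finset.univ.filter fun i => s i ≠ 0).card ≤ K ∧ (∑ j, |t j| ^ p) ^ (1 / p) ≤ 1 ∧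
      x = ∑ i, s i * ∑ j, A i j * g (i, j) * t j) :
    ∫ g, sSup (T g) ∂stdGaussian (Fin m × Fin n) ≤
      4 * (Real.exp 1 ^ 2 * momentScale r D a k) := by
  have hb := momentScale_pos hr hD ha k
  set b := momentScale r D a k
  set R := Real.exp 1 ^ 2 * b
  have hR : 0 < R := by positivity
  let S : (Fin m → ℝ) → (Fin m × Fin n → ℝ) → ℝ := fun v g => ∑ j, |∑ i, A i j * g (i, j) * v i| ^ r
  have hS : ∀ v g, 0 ≤ S v g := fun v g => Finset.sum_nonneg fun j _ => by positivity
  let M : (Fin m × Fin n → ℝ) → ℝ :=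
    fun g => 2 * (R * (1 + ∑ v ∈ ballNet m K, S v g ^ k / (R ^ r) ^ k))
  have hM0 : ∀ g, 0 ≤ M g := fun g => by
    have : 0 ≤ ∑ v ∈ ballNet m K, S v g ^ k / (R ^ r) ^ k :=
      Finset.sum_nonneg fun v _ => by have := hS v g; positivity
    positivity
  have hmom := fun v (hv : v ∈ ballNet m K) =>
    moment_column_sums A hk hr hD ha hAa hAD (Finset.mem_filter.mp hv).2
  have h_intble : Integrable (fun g => ∑ v ∈ ballNet m K, S v g ^ k / (R ^ r) ^ k)
      (stdGaussian (Fin m × Fin n)) :=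
    integrable_finsetSum _ fun v hv => (hmom v hv).1.div_const _
  have h_intble_one_add : Integrable (fun g => 1 + ∑ v ∈ ballNet m K, S v g ^ k / (R ^ r) ^ k)
      (stdGaussian (Fin m × Fin n)) := (integrable_const 1).add h_intble
  have hMint : Integrable M (stdGaussian (Fin m × Fin n)) := (h_intble_one_add.const_mul R).const_mul 2
  have hub : ∀ g, ∀ x ∈ T g, x ≤ M g := by
    intro g x hx
    obtain ⟨s, t, hs, hcs, ht, rfl⟩ := hT g x hx
    refine bilinear_le_of_ballNet hm hK hpr (fun i j => A i j * g (i, j)) (fun v hv => ?_) hs hcs ht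
    refine (rpow_le_mul_one_add_pow_div (hS v g) hR (by linarith) hk).trans ?_
    gcongr
    exact Finset.single_le_sum (f := fun v => S v g ^ k / (R ^ r) ^ k)
      (fun v _ => by have := hS v g; positivity) hv
  have hsup : ∀ g, sSup (T g) ≤ M g := fun g => Real.sSup_le (hub g) (hM0 g)
  have hsup0 : ∀ g, 0 ≤ sSup (T g) := fun g => le_csSup ⟨M g, hub g⟩ (hT0 g)
  have hRk : Real.exp (r * k) * (Real.exp 1 * b ^ r) ^ k ≤ (R ^ r) ^ k := by
    have h1 : R ^ r = Real.exp r * (Real.exp r * b ^ r) := by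
      rw [Real.mul_rpow (by positivity) hb.le, ← Real.exp_nat_mul, ← Real.exp_mul, ← mul_assoc,
        ← Real.exp_add]
      congr 2
      push_cast
      ring
    rw [h1, mul_pow (Real.exp r), ← Real.exp_nat_mul, mul_comm r]
    gcongr
    linarith
  have hsum : ∫ g, ∑ v ∈ ballNet m K, S v g ^ k / (R ^ r) ^ k ∂stdGaussian (Fin m × Fin n) ≤ 1 := by
    rw [integral_finsetSum _ fun v hv => (hmom v hv).1.div_const _]
    calc ∑ v ∈ ballNet m K, ∫ g, S v g ^ k / (R ^ r) ^ k ∂stdGaussian (Fin m × Fin n)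
        ≤ ∑ v ∈ ballNet m K, (Real.exp 1 * b ^ r) ^ k / (R ^ r) ^ k := by
          refine Finset.sum_le_sum fun v hv => ?_
          rw [integral_div]
          gcongr
          exact (hmom v hv).2
      _ = (ballNet m K).card * (Real.exp 1 * b ^ r) ^ k / (R ^ r) ^ k := by
          rw [Finset.sum_const, nsmul_eq_mul, mul_div_assoc]
      _ ≤ 1 := by
          rw [div_le_one (by positivity)]
          refine le_trans ?_ hRk
          gcongr
  calc ∫ g, sSup (T g) ∂stdGaussian (Fin m × Fin n)
      ≤ ∫ g, M g ∂stdGaussian (Fin m × Fin n) :=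
        integral_mono_of_nonneg (.of_forall hsup0) hMint (.of_forall hsup)
    _ = 2 * (R * (1 + ∫ g, ∑ v ∈ ballNet m K, S v g ^ k / (R ^ r) ^ k
          ∂stdGaussian (Fin m × Fin n))) := by
        rw [integral_const_mul, integral_const_mul, integral_add (integrable_const 1) h_intble]
        simp
    _ ≤ 2 * (R * (1 + 1)) := by gcongr
    _ = 4 * R := by ring

theorem one_le_Log (x : ℝ) : 1 ≤ Log x := le_max_left _ _

theorem card_ballNet_le_exp {m : ℕ} (hm : 0 < m) (K : ℕ) :
    ((ballNet m K).card : ℝ) ≤ Real.exp (4 * K * Log m) := by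
  have hm0 : (0 : ℝ) < m := by exact_mod_cast hm
  have hm1 : (1 : ℝ) ≤ m := by exact_mod_cast hm
  have h1 : (m : ℝ) ≤ Real.exp (Log m) := by
    rw [← Real.log_le_iff_le_exp hm0]
    exact le_max_right _ _
  have h2 : 2 ≤ Real.exp (Log m) := by
    have := Real.add_one_le_exp (Log (m : ℝ))
    linarith [one_le_Log m]
  set E := Real.exp (Log m)
  calc ((ballNet m K).card : ℝ) ≤ ((m * (2 * m + 1) : ℕ) : ℝ) ^ K := by
        exact_mod_cast card_ballNet_le m K
    _ ≤ (E ^ 4) ^ K := by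
        gcongr
        push_cast
        calc (m : ℝ) * (2 * m + 1) ≤ E * (E * 2 * 2) := by
              gcongr
              nlinarith
          _ ≤ E * (E * E * E) := by gcongr
          _ = E ^ 4 := by ring
    _ = Real.exp (4 * K * Log m) := by
        rw [← Real.exp_nat_mul, ← Real.exp_nat_mul]
        congr 1
        push_cast
        ring

theorem momentScale_ceil_le {r D a L : ℝ} (hr : 2 ≤ r) (ha : 0 ≤ a) (haD : a ≤ D) (hL : 0 ≤ L) :
    momentScale r D a ⌈4 * L / r⌉₊ ≤ 4 * Real.exp 1 * (√r * D + √L * a) := by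
  have hr0 : 0 < r := by linarith
  have h1 : (⌈4 * L / r⌉₊ : ℝ) * r ≤ 4 * L + r := by
    have h := (Nat.ceil_lt_add_one (show 0 ≤ 4 * L / r by positivity)).le
    calc (⌈4 * L / r⌉₊ : ℝ) * r ≤ (4 * L / r + 1) * r := by gcongr
      _ = 4 * L + r := by field_simp
  have h2 : √r * √(⌈4 * L / r⌉₊ : ℝ) ≤ 2 * √L + √r := by
    rw [← Real.sqrt_mul hr0.le, Real.sqrt_le_left (by positivity)]
    have h3 := Real.sq_sqrt hL
    have h4 := Real.sq_sqrt hr0.le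
    have h5 : 0 ≤ √L * √r := by positivity
    nlinarith
  have h6 : √r * a ≤ √r * D := by gcongr
  have h7 := mul_le_mul_of_nonneg_right h2 ha
  calc momentScale r D a ⌈4 * L / r⌉₊
      = 2 * Real.exp 1 * (√r * D + √r * √(⌈4 * L / r⌉₊ : ℝ) * a) := by
        unfold momentScale
        ring
    _ ≤ 2 * Real.exp 1 * (2 * (√r * D + √L * a)) := by
        gcongr
        linarith
    _ = 4 * Real.exp 1 * (√r * D + √L * a) := by ring

theorem toReal_holderConjugate {p r : ℝ≥0∞} (h : 1 / p + 1 / r = 1) (hr : 2 ≤ r) (hr' : r ≠ ⊤) :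
    r.toReal.HolderConjugate p.toReal := by
  have hr2 : 2 ≤ r.toReal := (ENNReal.ofReal_le_iff_le_toReal hr').mp (by simpa using hr)
  rw [Real.holderConjugate_iff]
  refine ⟨by linarith, ?_⟩
  have h1 : 1 / p ≠ ⊤ := fun h' => by simp [h'] at h
  have h2 : 1 / r ≠ ⊤ := fun h' => by simp [h'] at h
  have h3 := congrArg ENNReal.toReal h
  rw [ENNReal.toReal_add h1 h2] at h3
  simp only [one_div, ENNReal.toReal_inv, ENNReal.toReal_one] at h3
  linarith

theorem conjugate_ne_top {p r : ℝ≥0∞} (h : 1 / p + 1 / r = 1) (hr : 2 ≤ r) : p ≠ ⊤ := by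
  rintro rfl
  simp only [one_div, ENNReal.inv_top, zero_add, ENNReal.inv_eq_one] at h
  rw [h] at hr
  exact absurd hr (by norm_num)

theorem conjugate_toReal_mem_Icc {p r : ℝ≥0∞} (h : 1 / p + 1 / r = 1) (hr : 2 ≤ r) :
    p.toReal ∈ Set.Icc 1 2 := by
  have hp := conjugate_ne_top h hr
  constructor
  · have h1 : 1 / p ≤ 1 := le_self_add.trans h.le
    rw [one_div, ENNReal.inv_le_one] at h1
    simpa using ENNReal.toReal_mono hp h1
  · have h2 : (2 : ℝ≥0∞)⁻¹ ≤ p⁻¹ := by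
      by_contra! h3
      refine absurd h (ne_of_lt ?_)
      calc 1 / p + 1 / r < 2⁻¹ + 2⁻¹ := by
            rw [one_div, one_div]
            have h4 : r⁻¹ ≤ 2⁻¹ := ENNReal.inv_le_inv.mpr hr
            exact ENNReal.add_lt_add_of_lt_of_le (ne_top_of_le_ne_top (by simp) h4) h3 h4
        _ = 1 := ENNReal.inv_two_add_inv_two
    rw [ENNReal.inv_le_inv] at h2
    simpa using ENNReal.toReal_mono (by simp) h2

theorem sum_abs_rpow_le_of_lpNorm_le {r : ℝ≥0∞} (hr : r ≠ ⊤) (hr1 : 1 ≤ r.toReal)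
    {ι : Type*} [Fintype ι] {x : ι → ℝ} {D : ℝ} (hx : lpNorm r x ≤ D) :
    ∑ i, |x i| ^ r.toReal ≤ D ^ r.toReal := by
  have h0 : 0 ≤ ∑ i, |x i| ^ r.toReal := Finset.sum_nonneg fun i _ => by positivity
  rw [_root_.lpNorm, if_neg hr] at hx
  calc ∑ i, |x i| ^ r.toReal = ((∑ i, |x i| ^ r.toReal) ^ (1 / r.toReal)) ^ r.toReal := by
        rw [← Real.rpow_mul h0, one_div_mul_cancel (by linarith), Real.rpow_one]
    _ ≤ D ^ r.toReal := by gcongr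

theorem abs_le_lpNorm {r : ℝ≥0∞} (hr : r ≠ ⊤) (hr1 : 1 ≤ r.toReal)
    {ι : Type*} [Fintype ι] (x : ι → ℝ) (i : ι) : |x i| ≤ lpNorm r x := by
  have h0 : 0 ≤ ∑ i, |x i| ^ r.toReal := Finset.sum_nonneg fun i _ => by positivity
  rw [_root_.lpNorm, if_neg hr]
  calc |x i| = (|x i| ^ r.toReal) ^ (1 / r.toReal) := by
        rw [← Real.rpow_mul (abs_nonneg _), mul_one_div_cancel (by linarith), Real.rpow_one]
    _ ≤ (∑ i, |x i| ^ r.toReal) ^ (1 / r.toReal) := by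
        gcongr
        exact Finset.single_le_sum (f := fun i => |x i| ^ r.toReal)
          (fun j _ => by positivity) (Finset.mem_univ i)

theorem lpNorm_zero_fun {r : ℝ≥0∞} (hr : r ≠ ⊤) (hr1 : 1 ≤ r.toReal) {ι : Type*} [Fintype ι] :
    lpNorm r (fun _ : ι => 0) = 0 := by
  have : r.toReal ≠ 0 := by linarith
  simp [_root_.lpNorm, hr, this]

/-- Proposition: large coordinates of `s`:
`E sup_{s ∈ B_{q*}, t ∈ B_p} Σ a_{ij} g_{ij} s_i t_j 1_{|s_i| ≥ γ⁻¹}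
  ≤ C(√(p*) D1 + √(γ^{q*} Log m) max_{i,j}|a_{ij}|)`. -/
theorem prop_large_coordinates :
    ∃ C : ℝ, 0 < C ∧
      ∀ p pstar q qstar : ℝ≥0∞,
        1 / p + 1 / pstar = 1 → 1 / q + 1 / qstar = 1 →
        2 ≤ pstar → pstar ≠ ⊤ → 2 ≤ q →
        ∀ γ : ℝ, 1 ≤ γ →
        ∀ (m n : ℕ), 0 < m → 0 < n → ∀ A : Fin m → Fin n → ℝ,
          (∫ g : Fin m × Fin n → ℝ,
              sSup { x : ℝ | ∃ s : Fin m → ℝ, ∃ t : Fin n → ℝ,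
                lpNorm qstar s ≤ 1 ∧ lpNorm p t ≤ 1 ∧
                x = ∑ i, ∑ j,
                  if γ⁻¹ ≤ |s i| then A i j * g (i, j) * s i * t j else 0 }
            ∂ stdGaussian (Fin m × Fin n)) ≤
            C * (Real.sqrt pstar.toReal * D1 pstar A +
              Real.sqrt (γ ^ qstar.toReal * Log (m : ℝ)) * maxEntry A) := by
  refine ⟨16 * Real.exp 1 ^ 3, by positivity, ?_⟩
  intro p pstar q qstar hp hq hpstar hpstar' hq2 γ hγ m n hm hn A
  have hr2 : 2 ≤ pstar.toReal :=
    (ENNReal.ofReal_le_iff_le_toReal hpstar').mp (by simpa using hpstar)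
  have hpr := toReal_holderConjugate hp hpstar hpstar'
  have hptop := conjugate_ne_top hp hpstar
  have hqtop := conjugate_ne_top (add_comm (1 / q) (1 / qstar) ▸ hq) hq2
  obtain ⟨hu1, hu2⟩ := conjugate_toReal_mem_Icc (add_comm (1 / q) (1 / qstar) ▸ hq) hq2
  have hγ0 : 0 < γ := by linarith
  have hAa : ∀ i j, |A i j| ≤ maxEntry A := fun i j =>
    le_ciSup (f := fun ij : Fin m × Fin n => |A ij.1 ij.2|) (Set.finite_range _).bddAbove (i, j)
  have hAD : ∀ i, lpNorm pstar (A i) ≤ D1 pstar A := fun i =>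
    le_ciSup (f := fun i => lpNorm pstar (fun j => A i j)) (Set.finite_range _).bddAbove i
  have ha : 0 ≤ maxEntry A := (abs_nonneg _).trans (hAa ⟨0, hm⟩ ⟨0, hn⟩)
  have haD : maxEntry A ≤ D1 pstar A := by
    have : Nonempty (Fin m × Fin n) := ⟨(⟨0, hm⟩, ⟨0, hn⟩)⟩
    exact ciSup_le fun ij => (abs_le_lpNorm hpstar' (by linarith) (A ij.1) ij.2).trans (hAD ij.1)
  have hL : 0 ≤ γ ^ qstar.toReal * Log m := by
    have := one_le_Log m
    positivity
  rcases (ha.trans haD).eq_or_lt with hD | hD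
  · have hA : ∀ i j, A i j = 0 := fun i j =>
      abs_nonpos_iff.mp ((hAa i j).trans (haD.trans hD.ge))
    have hD0 : (0 : ℝ) ≤ D1 pstar A := ha.trans haD
    refine le_trans (integral_nonpos fun g => Real.sSup_nonpos ?_) (by positivity)
    rintro x ⟨s, t, -, -, rfl⟩
    simp [hA]
  set K := ⌊γ ^ qstar.toReal⌋₊
  have hK : 1 ≤ K := Nat.le_floor (by simpa using Real.one_le_rpow hγ (by linarith))
  have hKle : (K : ℝ) ≤ γ ^ qstar.toReal := Nat.floor_le (by positivity)
  set k := ⌈4 * (γ ^ qstar.toReal * Log m) / pstar.toReal⌉₊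
  have hr0 : 0 < pstar.toReal := by linarith
  have hk : 1 ≤ k := by
    have := one_le_Log m
    exact Nat.ceil_pos.mpr (by positivity)
  have hcard : ((ballNet m K).card : ℝ) ≤ Real.exp (pstar.toReal * k) := by
    refine (card_ballNet_le_exp hm K).trans (Real.exp_le_exp.mpr ?_)
    have h1 := Nat.le_ceil (4 * (γ ^ qstar.toReal * Log m) / pstar.toReal)
    rw [div_le_iff₀ hr0] at h1
    have h2 : (K : ℝ) * Log m ≤ γ ^ qstar.toReal * Log m := by
      have := one_le_Log m
      gcongr
    linarith
  refine (integral_sSup_le hm hK hk A hpr hr2 hD ha hAa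
    (fun i => sum_abs_rpow_le_of_lpNorm_le hpstar' (by linarith) (hAD i)) hcard
    (fun g => ?_) (fun g x hx => ?_)).trans ?_
  · refine ⟨fun _ => 0, fun _ => 0, ?_, ?_, by simp⟩
    · rw [lpNorm_zero_fun hqtop hu1]
      exact zero_le_one
    · rw [lpNorm_zero_fun hptop hpr.symm.lt.le]
      exact zero_le_one
  · obtain ⟨s, t, hs, ht, rfl⟩ := hx
    have hs' := sum_abs_rpow_le_of_lpNorm_le hqtop hu1 hs
    rw [Real.one_rpow] at hs'
    rw [_root_.lpNorm, if_neg hptop] at ht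
    refine ⟨fun i => if γ⁻¹ ≤ |s i| then s i else 0, t, sum_sq_truncation_le hu1 hu2 hs',
      card_truncation_le hu1 hγ hs', ht, ?_⟩
    refine Finset.sum_congr rfl fun i _ => ?_
    rw [Finset.mul_sum]
    refine Finset.sum_congr rfl fun j _ => ?_
    by_cases h : γ⁻¹ ≤ |s i|
    · simp only [if_pos h]
      ring
    · simp only [if_neg h, zero_mul]
  · have h1 := momentScale_ceil_le hr2 ha haD hL
    calc 4 * (Real.exp 1 ^ 2 * momentScale pstar.toReal (D1 pstar A) (maxEntry A) k)
        ≤ 4 * (Real.exp 1 ^ 2 * (4 * Real.exp 1 * (√pstar.toReal * D1 pstar A +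
            √(γ ^ qstar.toReal * Log m) * maxEntry A))) := by gcongr
      _ = _ := by ring
end
end

section
/- Let q ∈ [2,∞], p ∈ (1,2], and let A = (a_{ij})_{i≤m, j≤n} be a real matrix and (g_{ij}) i.i.d. standard Gaussians. For every fixed s in the unit ball of ℓ_{q*}^m: E sup_{t ∈ B_p^n} Σ_{i,j} a_{ij} g_{ij} s_i t_j = E ‖( Σ_{i≤m} a_{ij} g_{ij} s_i )_{j≤n}‖_{p*} ≤ √(p*)·max_{i≤m} ‖(a_{ij})_{j≤n}‖_{p*}. -/
open MeasureTheory ProbabilityTheory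
open scoped ENNReal NNReal

noncomputable section

lemma integrable_exp_sq_div_three_gaussianReal :
    Integrable (fun x : ℝ => Real.exp (x ^ 2 / 3)) (gaussianReal 0 1) := by
  rw [gaussianReal_of_var_ne_zero _ one_ne_zero,
    integrable_withDensity_iff_integrable_smul' (measurable_gaussianPDF _ _)
      (ae_of_all _ fun _ => gaussianPDF_lt_top)]
  refine ((integrable_exp_neg_mul_sq (b := 1 / 6) (by norm_num)).const_mul
    (√(2 * Real.pi))⁻¹).congr (ae_of_all _ fun x => ?_)
  simp only [toReal_gaussianPDF, gaussianPDFReal, smul_eq_mul, NNReal.coe_one, mul_one, sub_zero]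
  rw [mul_assoc, ← Real.exp_add]
  congr 2
  ring

/-- The exponential square moment `E exp(g²/3) = √3`. -/
lemma integral_exp_sq_div_three_gaussianReal :
    ∫ x : ℝ, Real.exp (x ^ 2 / 3) ∂gaussianReal 0 1 = √3 := by
  rw [integral_gaussianReal_eq_integral_smul one_ne_zero]
  have h (x : ℝ) : gaussianPDFReal 0 1 x • Real.exp (x ^ 2 / 3) =
      (√(2 * Real.pi))⁻¹ * Real.exp (-(1 / 6) * x ^ 2) := by
    simp only [gaussianPDFReal, smul_eq_mul, NNReal.coe_one, mul_one, sub_zero]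
    rw [mul_assoc, ← Real.exp_add]
    congr 2
    ring
  simp_rw [h]
  rw [integral_const_mul, integral_gaussian, ← Real.sqrt_inv, ← Real.sqrt_mul (by positivity)]
  congr 1
  have := Real.pi_ne_zero
  field_simp
  norm_num

lemma abs_rpow_le_mul_exp_sq_div_three {r : ℝ} (hr : 0 < r) (x : ℝ) :
    |x| ^ r ≤ (3 * r / 2) ^ (r / 2) * Real.exp (-(r / 2)) * Real.exp (x ^ 2 / 3) := by
  have h1 : x ^ 2 ≤ (3 * r / 2) * Real.exp (x ^ 2 / (3 * r / 2) - 1) := by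
    have := Real.add_one_le_exp (x ^ 2 / (3 * r / 2) - 1)
    rw [sub_add_cancel, div_le_iff₀ (by positivity)] at this
    linarith
  calc |x| ^ r = (x ^ 2) ^ (r / 2) := by
        rw [← sq_abs, ← Real.rpow_natCast, ← Real.rpow_mul (abs_nonneg x)]
        congr 1
        push_cast
        ring
    _ ≤ ((3 * r / 2) * Real.exp (x ^ 2 / (3 * r / 2) - 1)) ^ (r / 2) :=
        Real.rpow_le_rpow (sq_nonneg x) h1 (by positivity)
    _ = _ := by
        rw [Real.mul_rpow (by positivity) (by positivity), ← Real.exp_mul, mul_assoc,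
          ← Real.exp_add]
        congr 2
        field_simp
        ring

lemma integrable_abs_rpow_gaussianReal {r : ℝ} (hr : 0 < r) (μ : ℝ) (v : ℝ≥0) :
    Integrable (fun x : ℝ => |x| ^ r) (gaussianReal μ v) := by
  have h := (memLp_id_gaussianReal' (μ := μ) (v := v) (ENNReal.ofReal r)
    ENNReal.ofReal_ne_top).integrable_norm_rpow (by simpa using hr) ENNReal.ofReal_ne_top
  simpa [ENNReal.toReal_ofReal hr.le] using h

/-- Absolute moments of a standard Gaussian: `E|g|^r ≤ r^{r/2}` for `r ≥ 2`. -/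
lemma integral_abs_rpow_gaussianReal_le {r : ℝ} (hr : 2 ≤ r) :
    ∫ x : ℝ, |x| ^ r ∂gaussianReal 0 1 ≤ r ^ (r / 2) := by
  have hr0 : 0 < r := by linarith
  have h3 : (3 / 2 * Real.exp (-1)) * √3 ≤ 1 := by
    have hsqrt : √3 ≤ 1.75 := Real.sqrt_le_iff.2 ⟨by norm_num, by norm_num⟩
    rw [Real.exp_neg]
    have he := Real.exp_one_gt_d9
    rw [mul_assoc, inv_mul_eq_div, ← mul_div_assoc, div_le_one (by positivity)]
    linarith
  have h2 : 3 / 2 * Real.exp (-1) ≤ 1 := by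
    refine le_trans ?_ h3
    exact le_mul_of_one_le_right (by positivity) (Real.one_le_sqrt.2 (by norm_num))
  calc ∫ x : ℝ, |x| ^ r ∂gaussianReal 0 1
      ≤ ∫ x : ℝ, (3 * r / 2) ^ (r / 2) * Real.exp (-(r / 2)) * Real.exp (x ^ 2 / 3)
          ∂gaussianReal 0 1 :=
        integral_mono (integrable_abs_rpow_gaussianReal hr0 0 1)
          (integrable_exp_sq_div_three_gaussianReal.const_mul _)
          (abs_rpow_le_mul_exp_sq_div_three hr0)
    _ = r ^ (r / 2) * ((3 / 2 * Real.exp (-1)) ^ (r / 2) * √3) := by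
        rw [integral_const_mul, integral_exp_sq_div_three_gaussianReal,
          Real.mul_rpow (by norm_num) (by positivity), ← Real.exp_mul,
          show 3 * r / 2 = r * (3 / 2) by ring, Real.mul_rpow hr0.le (by norm_num)]
        ring_nf
    _ ≤ r ^ (r / 2) * 1 := by
        gcongr
        refine le_trans ?_ h3
        gcongr
        simpa using Real.rpow_le_rpow_of_exponent_ge (by positivity) h2
          (show (1 : ℝ) ≤ r / 2 by linarith)
    _ = _ := mul_one _

/-- A linear combination of iid standard Gaussians is a centred Gaussian. -/
lemma map_sum_mul_stdGaussian {κ : Type*} [Fintype κ] (c : κ → ℝ) :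
    (stdGaussian κ).map (fun g : κ → ℝ => ∑ k, c k * g k) =
      (gaussianReal 0 1).map (fun x => √(∑ k, c k ^ 2) * x) := by
  rw [gaussianReal_map_const_mul]
  have : IsProbabilityMeasure (stdGaussian κ) := by unfold _root_.stdGaussian; infer_instance
  have hm : Measurable (fun g : κ → ℝ => ∑ k, c k * g k) := by fun_prop
  have := Measure.isProbabilityMeasure_map (μ := stdGaussian κ) hm.aemeasurable
  refine Measure.ext_of_charFun ?_
  ext t
  rw [charFun_gaussianReal, charFun_apply_real, integral_map hm.aemeasurable (by fun_prop)]
  have h (g : κ → ℝ) : Complex.exp (t * (∑ k, c k * g k : ℝ) * Complex.I) =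
      ∏ k, Complex.exp ((t * c k : ℝ) * g k * Complex.I) := by
    rw [← Complex.exp_sum]
    congr 1
    push_cast
    rw [Finset.mul_sum, Finset.sum_mul]
    exact Finset.sum_congr rfl fun k _ => by ring
  simp_rw [h]
  unfold _root_.stdGaussian
  rw [integral_fintype_prod_eq_prod (fun k (x : ℝ) =>
    Complex.exp ((t * c k : ℝ) * x * Complex.I))]
  simp_rw [← charFun_apply_real, charFun_gaussianReal]
  rw [← Complex.exp_sum]
  congr 1
  have hs : ((√(∑ k, c k ^ 2) : ℝ) : ℂ) ^ 2 = ∑ k, (c k : ℂ) ^ 2 := by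
    rw [← Complex.ofReal_pow, Real.sq_sqrt (Finset.sum_nonneg fun k _ => sq_nonneg _)]
    push_cast
    rfl
  simp [← Finset.sum_div, ← Finset.mul_sum, mul_pow, hs, mul_comm]

lemma integrable_abs_sum_mul_rpow_stdGaussian {κ : Type*} [Fintype κ] (c : κ → ℝ) {r : ℝ}
    (hr : 0 < r) :
    Integrable (fun g : κ → ℝ => |∑ k, c k * g k| ^ r) (stdGaussian κ) := by
  have hm : Measurable (fun g : κ → ℝ => ∑ k, c k * g k) := by fun_prop
  have h : Integrable (fun x : ℝ => |x| ^ r)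
      ((stdGaussian κ).map (fun g : κ → ℝ => ∑ k, c k * g k)) := by
    rw [map_sum_mul_stdGaussian, gaussianReal_map_const_mul]
    exact integrable_abs_rpow_gaussianReal hr _ _
  exact h.comp_measurable hm

/-- Moments of a linear combination of iid standard Gaussians. -/
lemma integral_abs_sum_mul_rpow_stdGaussian_le {κ : Type*} [Fintype κ] (c : κ → ℝ) {r : ℝ}
    (hr : 2 ≤ r) :
    ∫ g : κ → ℝ, |∑ k, c k * g k| ^ r ∂stdGaussian κ ≤
      (∑ k, c k ^ 2) ^ (r / 2) * r ^ (r / 2) := by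
  have hm : Measurable (fun g : κ → ℝ => ∑ k, c k * g k) := by fun_prop
  have hmr : Measurable (fun x : ℝ => |x| ^ r) := by fun_prop
  rw [← integral_map (f := fun x : ℝ => |x| ^ r) hm.aemeasurable hmr.aestronglyMeasurable,
    map_sum_mul_stdGaussian, integral_map (by fun_prop) hmr.aestronglyMeasurable]
  simp_rw [abs_mul, Real.mul_rpow (abs_nonneg _) (abs_nonneg _)]
  rw [integral_const_mul, abs_of_nonneg (Real.sqrt_nonneg _), Real.sqrt_eq_rpow,
    ← Real.rpow_mul (Finset.sum_nonneg fun k _ => sq_nonneg _), one_div_mul_eq_div]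
  gcongr
  exact integral_abs_rpow_gaussianReal_le hr

lemma lpNorm_of_ne_top {r : ℝ≥0∞} (hr : r ≠ ⊤) {ι : Type*} [Fintype ι] (x : ι → ℝ) :
    lpNorm r x = (∑ i, |x i| ^ r.toReal) ^ (1 / r.toReal) := if_neg hr

lemma sum_abs_rpow_le_one {r : ℝ≥0∞} (hr : r ≠ ⊤) (hr0 : 0 < r.toReal) {ι : Type*} [Fintype ι]
    {x : ι → ℝ} (hx : lpNorm r x ≤ 1) : ∑ i, |x i| ^ r.toReal ≤ 1 := by
  rw [lpNorm_of_ne_top hr] at hx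
  by_contra! h
  exact absurd hx (not_le.2 (Real.one_lt_rpow h (by positivity)))

/-- Duality of the finite-dimensional `ℓ_p` and `ℓ_{p*}` norms. -/
lemma isGreatest_lpNorm {p pstar : ℝ≥0∞} (hp : p ≠ ⊤) (hps : pstar ≠ ⊤)
    (h : p.toReal.HolderConjugate pstar.toReal) {ι : Type*} [Fintype ι] (x : ι → ℝ) :
    IsGreatest {y : ℝ | ∃ t : ι → ℝ, lpNorm p t ≤ 1 ∧ y = ∑ j, x j * t j} (lpNorm pstar x) := by
  have hp0 := h.pos
  constructor
  · obtain ⟨g, hg, hgx⟩ :=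
      (NNReal.isGreatest_Lp Finset.univ (fun j => ‖x j‖₊) h.symm).1
    refine ⟨fun j => SignType.sign (x j) * g j, ?_, ?_⟩
    · rw [lpNorm_of_ne_top hp]
      refine Real.rpow_le_one (Finset.sum_nonneg fun i _ => by positivity) ?_ (by positivity)
      have hg' : ∑ j, (g j : ℝ) ^ p.toReal ≤ 1 := by exact_mod_cast hg
      refine le_trans (Finset.sum_le_sum fun j _ => ?_) hg'
      refine Real.rpow_le_rpow (abs_nonneg _) ?_ hp0.le
      rw [abs_mul, NNReal.abs_eq]
      refine mul_le_of_le_one_left (g j).2 ?_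
      rcases lt_trichotomy (x j) 0 with hx | hx | hx <;> simp [hx]
    · rw [lpNorm_of_ne_top hps]
      have hgx' := congrArg ((↑) : ℝ≥0 → ℝ) hgx
      push_cast at hgx'
      simp only [Real.norm_eq_abs] at hgx'
      rw [← hgx']
      refine Finset.sum_congr rfl fun j _ => ?_
      rw [← mul_assoc, mul_comm (x j), sign_mul_self]
  · rintro _ ⟨t, ht, rfl⟩
    have h1 := Real.inner_le_Lp_mul_Lq Finset.univ x t h.symm
    rw [← lpNorm_of_ne_top hps, ← lpNorm_of_ne_top hp] at h1
    refine h1.trans (mul_le_of_le_one_right ?_ ht)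
    rw [lpNorm_of_ne_top hps]
    positivity

/-- The Jensen inequality for the concave function `y ↦ y ^ a`, `a ∈ [0,1]`. -/
lemma integral_rpow_le_rpow_integral {Ω : Type*} [MeasurableSpace Ω] {μ : Measure Ω}
    [IsProbabilityMeasure μ] {f : Ω → ℝ} (hf : Integrable f μ) (hf0 : 0 ≤ f) {a : ℝ}
    (ha0 : 0 ≤ a) (ha1 : a ≤ 1) : ∫ ω, f ω ^ a ∂μ ≤ (∫ ω, f ω ∂μ) ^ a := by
  by_cases hi : Integrable (fun ω => f ω ^ a) μ
  · exact (Real.concaveOn_rpow ha0 ha1).le_map_integral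
      (Real.continuous_rpow_const ha0).continuousOn isClosed_Ici (ae_of_all _ hf0) hf hi
  · rw [integral_undef hi]
    exact Real.rpow_nonneg (integral_nonneg hf0) _

/-- Convexity of `y ↦ y ^ a`, `a ≥ 1`, with subprobability weights. -/
lemma sum_mul_rpow_le_sum_mul_rpow {ι : Type*} [Fintype ι] {w f : ι → ℝ} (hw : ∀ i, 0 ≤ w i)
    (hw1 : ∑ i, w i ≤ 1) (hf : ∀ i, 0 ≤ f i) {a : ℝ} (ha : 1 ≤ a) :
    (∑ i, w i * f i) ^ a ≤ ∑ i, w i * f i ^ a := by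
  have hS : 0 ≤ ∑ i, w i * f i ^ a :=
    Finset.sum_nonneg fun i _ => mul_nonneg (hw i) (Real.rpow_nonneg (hf i) _)
  have h := Real.inner_le_weight_mul_Lp_of_nonneg Finset.univ ha w f hw hf
  have h1 : (∑ i, w i) ^ (1 - a⁻¹) ≤ 1 :=
    Real.rpow_le_one (Finset.sum_nonneg fun i _ => hw i) hw1
      (sub_nonneg.2 (inv_le_one_of_one_le₀ ha))
  have h2 := h.trans (mul_le_of_le_one_left (Real.rpow_nonneg hS _) h1)
  calc (∑ i, w i * f i) ^ a ≤ ((∑ i, w i * f i ^ a) ^ a⁻¹) ^ a :=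
        Real.rpow_le_rpow (Finset.sum_nonneg fun i _ => mul_nonneg (hw i) (hf i)) h2
          (by linarith)
    _ = _ := Real.rpow_inv_rpow hS (by linarith)

/-- The `ℓ_2` norm is dominated by the `ℓ_r` norm, `1 ≤ r ≤ 2`, on unit balls. -/
lemma sum_sq_le_one_of_lpNorm_le_one {r : ℝ≥0∞} (hr1 : 1 ≤ r) (hr2 : r ≤ 2) {ι : Type*}
    [Fintype ι] {x : ι → ℝ} (hx : lpNorm r x ≤ 1) : ∑ i, x i ^ 2 ≤ 1 := by
  have hr : r ≠ ⊤ := ne_top_of_le_ne_top (by simp) hr2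
  have hr1' : 1 ≤ r.toReal := by simpa using ENNReal.toReal_mono hr hr1
  have hr_le : r.toReal ≤ 2 := by simpa using ENNReal.toReal_mono (by simp) hr2
  have hr0 : 0 < r.toReal := by linarith
  have hsum := sum_abs_rpow_le_one hr hr0 hx
  refine le_trans (Finset.sum_le_sum fun i _ => ?_) hsum
  have hi : |x i| ^ r.toReal ≤ 1 :=
    (Finset.single_le_sum (f := fun i => |x i| ^ r.toReal) (fun j _ => by positivity)
      (Finset.mem_univ i)).trans hsum
  have hxi : |x i| ≤ 1 := by
    by_contra! h
    exact absurd hi (not_le.2 (Real.one_lt_rpow h hr0))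
  rw [← sq_abs, ← Real.rpow_two]
  rcases (abs_nonneg (x i)).eq_or_lt with h | h
  · simp [← h, hr0.ne']
  · exact Real.rpow_le_rpow_of_exponent_ge h hxi hr_le

/-- Each row satisfies `∑_j |a_{ij}|^{p*} ≤ D1^{p*}`. -/
lemma sum_abs_rpow_le_D1_rpow {r : ℝ≥0∞} (hr : r ≠ ⊤) (hr0 : 0 < r.toReal) {m n : ℕ}
    (A : Fin m → Fin n → ℝ) (i : Fin m) :
    ∑ j, |A i j| ^ r.toReal ≤ D1 r A ^ r.toReal := by
  have h : lpNorm r (fun j => A i j) ≤ D1 r A :=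
    le_ciSup (f := fun i => lpNorm r (fun j => A i j)) (Set.finite_range _).bddAbove i
  rw [lpNorm_of_ne_top hr] at h
  calc ∑ j, |A i j| ^ r.toReal
      = ((∑ j, |A i j| ^ r.toReal) ^ (1 / r.toReal)) ^ r.toReal := by
        rw [one_div, Real.rpow_inv_rpow (by positivity) hr0.ne']
    _ ≤ _ := Real.rpow_le_rpow (by positivity) h hr0.le

lemma D1_nonneg {r : ℝ≥0∞} (hr : r ≠ ⊤) {m n : ℕ} (A : Fin m → Fin n → ℝ) : 0 ≤ D1 r A :=
  Real.iSup_nonneg fun i => by rw [lpNorm_of_ne_top hr]; positivity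

/-- The variances of the columns of `(∑_i a_{ij} g_{ij} s_i)_j` satisfy
`∑_j (∑_i a_{ij}² s_i²)^{p*/2} ≤ D1^{p*}`. -/
lemma sum_sum_sq_rpow_le_D1_rpow {r : ℝ≥0∞} (hr : r ≠ ⊤) (hr2 : 2 ≤ r.toReal) {m n : ℕ}
    (A : Fin m → Fin n → ℝ) {s : Fin m → ℝ} (hs : ∑ i, s i ^ 2 ≤ 1) :
    ∑ j, (∑ i, (A i j * s i) ^ 2) ^ (r.toReal / 2) ≤ D1 r A ^ r.toReal := by
  have hr0 : 0 < r.toReal := by linarith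
  have habs (x : ℝ) : (x ^ 2) ^ (r.toReal / 2) = |x| ^ r.toReal := by
    rw [← sq_abs, ← Real.rpow_natCast, ← Real.rpow_mul (abs_nonneg x)]
    congr 1
    push_cast
    ring
  calc ∑ j, (∑ i, (A i j * s i) ^ 2) ^ (r.toReal / 2)
      ≤ ∑ j, ∑ i, s i ^ 2 * |A i j| ^ r.toReal := by
        refine Finset.sum_le_sum fun j _ => ?_
        have h := sum_mul_rpow_le_sum_mul_rpow (fun i => sq_nonneg (s i)) hs
          (fun i => sq_nonneg (A i j)) (show 1 ≤ r.toReal / 2 by linarith)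
        simp_rw [habs] at h
        simpa only [mul_pow, mul_comm] using h
    _ = ∑ i, s i ^ 2 * ∑ j, |A i j| ^ r.toReal := by
        rw [Finset.sum_comm]
        simp_rw [Finset.mul_sum]
    _ ≤ ∑ i, s i ^ 2 * D1 r A ^ r.toReal := by
        gcongr with i
        exact sum_abs_rpow_le_D1_rpow hr hr0 A i
    _ ≤ D1 r A ^ r.toReal := by
        rw [← Finset.sum_mul]
        exact mul_le_of_le_one_left (Real.rpow_nonneg (D1_nonneg hr A) _) hs

/-- The Gaussian half of the fixed-`s` estimate, for `s` in the Euclidean unit ball. -/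
lemma integral_lpNorm_le_sqrt_mul_D1 {r : ℝ≥0∞} (hr : r ≠ ⊤) (hr2 : 2 ≤ r.toReal) {m n : ℕ}
    (A : Fin m → Fin n → ℝ) {s : Fin m → ℝ} (hs : ∑ i, s i ^ 2 ≤ 1) :
    (∫ g : Fin m × Fin n → ℝ, lpNorm r (fun j => ∑ i, A i j * g (i, j) * s i)
      ∂ stdGaussian (Fin m × Fin n)) ≤ √r.toReal * D1 r A := by
  have hr0 : 0 < r.toReal := by linarith
  have : IsProbabilityMeasure (stdGaussian (Fin m × Fin n)) := by
    unfold _root_.stdGaussian; infer_instance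
  let c (j : Fin n) (k : Fin m × Fin n) : ℝ := if k.2 = j then A k.1 k.2 * s k.1 else 0
  have hlin (g : Fin m × Fin n → ℝ) (j : Fin n) :
      ∑ i, A i j * g (i, j) * s i = ∑ k, c j k * g k := by
    simp [c, Fintype.sum_prod_type, mul_right_comm]
  have hvar (j : Fin n) : ∑ k, c j k ^ 2 = ∑ i, (A i j * s i) ^ 2 := by
    simp [c, Fintype.sum_prod_type, ite_pow]
  have hint (j : Fin n) := integrable_abs_sum_mul_rpow_stdGaussian (c j) hr0
  simp_rw [lpNorm_of_ne_top hr, hlin]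
  calc ∫ g : Fin m × Fin n → ℝ, (∑ j, |∑ k, c j k * g k| ^ r.toReal) ^ (1 / r.toReal)
        ∂ stdGaussian (Fin m × Fin n)
      ≤ (∫ g : Fin m × Fin n → ℝ, ∑ j, |∑ k, c j k * g k| ^ r.toReal
          ∂ stdGaussian (Fin m × Fin n)) ^ (1 / r.toReal) :=
        integral_rpow_le_rpow_integral (integrable_finsetSum _ fun j _ => hint j)
          (fun g => Finset.sum_nonneg fun j _ => by positivity) (by positivity)
          ((div_le_one hr0).2 (by linarith))
    _ ≤ (r.toReal ^ (r.toReal / 2) * D1 r A ^ r.toReal) ^ (1 / r.toReal) := by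
        refine Real.rpow_le_rpow (integral_nonneg fun g =>
          Finset.sum_nonneg fun j _ => by positivity) ?_ (by positivity)
        rw [integral_finsetSum _ fun j _ => hint j, mul_comm]
        refine le_trans (Finset.sum_le_sum fun j _ =>
          integral_abs_sum_mul_rpow_stdGaussian_le (c j) hr2) ?_
        simp_rw [hvar, ← Finset.sum_mul]
        gcongr
        exact sum_sum_sq_rpow_le_D1_rpow hr hr2 A hs
    _ = √r.toReal * D1 r A := by
        have hD := D1_nonneg hr A
        rw [Real.mul_rpow (by positivity) (by positivity), ← Real.rpow_mul hr0.le,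
          ← Real.rpow_mul hD, mul_one_div_cancel hr0.ne', Real.rpow_one, Real.sqrt_eq_rpow]
        congr 2
        field_simp

/-- the fixed-`s` lemma: for `q ∈ [2,∞]`, `p ∈ (1,2]` and a fixed
`s` in the unit ball of `ℓ_{q*}^m`,
`E sup_{t ∈ B_p} Σ a_{ij} g_{ij} s_i t_j = E‖(Σ_i a_{ij} g_{ij} s_i)_j‖_{p*} ≤ √(p*) D1`. -/
theorem fixed_s_lemma
    (p pstar q qstar : ℝ≥0∞)
    (hpc : 1 / p + 1 / pstar = 1) (hqc : 1 / q + 1 / qstar = 1)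
    (hp1 : 1 < p) (hp2 : p ≤ 2) (hq : 2 ≤ q)
    (m n : ℕ) (hm : 0 < m) (hn : 0 < n) (A : Fin m → Fin n → ℝ)
    (s : Fin m → ℝ) (hs : lpNorm qstar s ≤ 1) :
    (∫ g : Fin m × Fin n → ℝ,
        sSup { x : ℝ | ∃ t : Fin n → ℝ, lpNorm p t ≤ 1 ∧
          x = ∑ i, ∑ j, A i j * g (i, j) * s i * t j }
      ∂ stdGaussian (Fin m × Fin n)) =
      (∫ g : Fin m × Fin n → ℝ,
        lpNorm pstar (fun j => ∑ i, A i j * g (i, j) * s i)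
      ∂ stdGaussian (Fin m × Fin n)) ∧
    (∫ g : Fin m × Fin n → ℝ,
        lpNorm pstar (fun j => ∑ i, A i j * g (i, j) * s i)
      ∂ stdGaussian (Fin m × Fin n)) ≤
      Real.sqrt pstar.toReal * D1 pstar A := by
  have : p.HolderConjugate pstar := ENNReal.holderConjugate_iff.2 (by simpa using hpc)
  have hp : p ≠ ⊤ := ne_top_of_le_ne_top (by simp) hp2
  have hp1' : 1 < p.toReal := by simpa using (ENNReal.toReal_lt_toReal (by simp) hp).2 hp1
  have hp2' : p.toReal ≤ 2 := by simpa using ENNReal.toReal_mono (by simp) hp2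
  have hconj : p.toReal.HolderConjugate pstar.toReal :=
    (ENNReal.HolderConjugate.toReal_iff hp1').2 ‹_›
  have hps : pstar ≠ ⊤ := by
    rintro rfl
    simpa using hconj.symm.pos
  have hps2 : 2 ≤ pstar.toReal := by
    have h1 := hconj.inv_add_inv_eq_one
    have h2 : (2 : ℝ)⁻¹ ≤ p.toReal⁻¹ := inv_anti₀ (by linarith) hp2'
    have h3 : pstar.toReal⁻¹ ≤ (2 : ℝ)⁻¹ := by linarith
    exact (inv_le_inv₀ hconj.symm.pos (by norm_num)).1 h3
  have hqs1 : 1 ≤ qstar := by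
    have h : 1 / qstar ≤ 1 / q + 1 / qstar := le_add_self
    rw [hqc] at h
    simpa using h
  have hqs2 : qstar ≤ 2 := by
    by_contra! h
    have h1 : 1 / q ≤ 2⁻¹ := by simpa using hq
    have h2 : 1 / qstar < 2⁻¹ := by simpa using h
    have h3 := ENNReal.add_lt_add_of_le_of_lt (ne_top_of_le_ne_top (by simp) h1) h1 h2
    rw [hqc, ENNReal.inv_two_add_inv_two] at h3
    exact lt_irrefl _ h3
  refine ⟨?_, integral_lpNorm_le_sqrt_mul_D1 hps hps2 A
    (sum_sq_le_one_of_lpNorm_le_one hqs1 hqs2 hs)⟩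
  congr 1
  ext g
  rw [← (isGreatest_lpNorm hp hps hconj _).csSup_eq]
  simp_rw [Finset.sum_mul]
  congr! 5 with x t
  rw [Finset.sum_comm]
end
end
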